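/- arXiv:2404.09250 — 3 statements merged into one kernel-verified Lean document; each statement's English description precedes it below -/
import Mathlib

section
/- Let x, y ∈ M_n(ℂ) be positive semidefinite and let |||·||| be any unitarily invariant norm on M_n(ℂ). Then for every t ∈ [3/4, 1], |||y^{1-t} x^{2t-1} y^{1-t} + x^{1-t} y^{2t-1} x^{1-t}||| ≤ |||x + y|||. -/
open scoped Matrix ComplexOrder

/-- The real power `A^s` of a positive semidefinite matrix, defined via the spectral
decomposition (equivalently, the continuous functional calculus), with the convention
`A^0 = 1`.  (If `A` is not Hermitian we return the junk value `0`.) -/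
noncomputable def psdPow {N : ℕ} (A : Matrix (Fin N) (Fin N) ℂ) (s : ℝ) :
    Matrix (Fin N) (Fin N) ℂ :=
  if hA : A.IsHermitian then
    (Matrix.IsHermitian.eigenvectorUnitary hA : Matrix (Fin N) (Fin N) ℂ) *
      Matrix.diagonal (fun i => ((hA.eigenvalues i ^ s : ℝ) : ℂ)) *
      (Matrix.IsHermitian.eigenvectorUnitary hA : Matrix (Fin N) (Fin N) ℂ)ᴴ
  else 0

lemma young_two_term {z η a b θ : ℝ} (hz : 0 ≤ z) (hη : 0 ≤ η) (hb : 0 < b) (hθ0 : 0 ≤ θ)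
    (hθ1 : θ ≤ 1) (hab : θ * b = 2 * a) :
    (2 - θ) * (z * η ^ (2 * a)) ≤
      θ * (z ^ θ * η ^ b) + 2 * (1 - θ) * (z ^ (1 + θ / 2) * η ^ a) := by
  have h2 : 0 < 2 - θ := by linarith
  have ha : a = θ * b / 2 := by linarith
  have key := Real.geom_mean_le_arith_mean2_weighted
    (w₁ := θ / (2 - θ)) (w₂ := 2 * (1 - θ) / (2 - θ)) (p₁ := z ^ θ * η ^ b)
    (p₂ := z ^ (1 + θ / 2) * η ^ a) (by positivity)
    (div_nonneg (by linarith) h2.le) (by positivity) (by positivity)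
    (by field_simp; ring)
  have hw2 : 0 ≤ 2 * (1 - θ) / (2 - θ) := div_nonneg (by linarith) h2.le
  have ha0 : 0 ≤ a := by rw [ha]; positivity
  have e : (z ^ θ * η ^ b) ^ (θ / (2 - θ)) * (z ^ (1 + θ / 2) * η ^ a) ^ (2 * (1 - θ) / (2 - θ))
      = z * η ^ (2 * a) := by
    rw [Real.mul_rpow (by positivity) (by positivity), Real.mul_rpow (by positivity) (by positivity),
      ← Real.rpow_mul hz, ← Real.rpow_mul hz, ← Real.rpow_mul hη, ← Real.rpow_mul hη,
      mul_mul_mul_comm, ← Real.rpow_add_of_nonneg hz (by positivity) (by positivity),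
      ← Real.rpow_add_of_nonneg hη (by positivity) (by positivity)]
    have e1 : θ * (θ / (2 - θ)) + (1 + θ / 2) * (2 * (1 - θ) / (2 - θ)) = 1 := by
      field_simp; ring
    have e2 : b * (θ / (2 - θ)) + a * (2 * (1 - θ) / (2 - θ)) = 2 * a := by
      rw [ha]; field_simp; ring
    rw [e1, e2, Real.rpow_one]
  rw [e] at key
  calc (2 - θ) * (z * η ^ (2 * a)) ≤ (2 - θ) * (θ / (2 - θ) * (z ^ θ * η ^ b) +
        2 * (1 - θ) / (2 - θ) * (z ^ (1 + θ / 2) * η ^ a)) := by gcongr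
    _ = _ := by field_simp

lemma young_power {z η b θ : ℝ} (hz : 0 ≤ z) (hη : 0 ≤ η) (hθ0 : 0 ≤ θ)
    (hb : (1 + θ) * b = 1) :
    (1 + θ) * (z ^ θ * η ^ b) ≤ η + θ * z ^ (1 + θ) := by
  have h1 : 0 < 1 + θ := by linarith
  have key := Real.geom_mean_le_arith_mean2_weighted
    (w₁ := 1 / (1 + θ)) (w₂ := θ / (1 + θ)) (p₁ := η) (p₂ := z ^ (1 + θ)) (by positivity)
    (by positivity) hη (by positivity) (by field_simp)
  have hb' : 1 / (1 + θ) = b := by field_simp; linarith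
  rw [← Real.rpow_mul hz, hb', mul_div_cancel₀ _ h1.ne'] at key
  calc (1 + θ) * (z ^ θ * η ^ b) = (1 + θ) * (η ^ b * z ^ θ) := by ring
    _ ≤ (1 + θ) * (b * η + θ / (1 + θ) * z ^ (1 + θ)) := by gcongr
    _ = (1 + θ) * b * η + θ * z ^ (1 + θ) := by field_simp
    _ = _ := by rw [hb, one_mul]

lemma Matrix.exists_unitary_mul_isHermitian {κ : Type*} [Fintype κ] [DecidableEq κ]
    (A : Matrix κ κ ℂ) : ∃ U ∈ Matrix.unitaryGroup κ ℂ, (A * U).IsHermitian := by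
  have hP : (A * Aᴴ).PosSemidef := Matrix.posSemidef_self_mul_conjTranspose A
  set W : Matrix κ κ ℂ := (hP.1.eigenvectorUnitary : Matrix κ κ ℂ) with hW
  have hWW : Wᴴ * W = 1 := by
    have := (Matrix.mem_unitaryGroup_iff').1 hP.1.eigenvectorUnitary.2
    simpa [Matrix.star_eq_conjTranspose] using this
  have hWW' : W * Wᴴ = 1 := mul_eq_one_comm.1 hWW
  set d := hP.1.eigenvalues with hd
  have hd0 : ∀ i, 0 ≤ d i := hP.eigenvalues_nonneg
  set B := Wᴴ * A with hB
  have hBB : B * Bᴴ = Matrix.diagonal (fun i => (d i : ℂ)) := by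
    have h := hP.1.spectral_theorem
    rw [Unitary.conjStarAlgAut_apply] at h
    change A * Aᴴ = W * _ * Wᴴ at h
    calc B * Bᴴ = Wᴴ * (A * Aᴴ) * W := by
          simp [hB, Matrix.conjTranspose_mul, Matrix.mul_assoc]
      _ = (Wᴴ * W) * Matrix.diagonal (fun i => (d i : ℂ)) * (Wᴴ * W) := by
          rw [h]; simp only [Matrix.mul_assoc]; rfl
      _ = _ := by rw [hWW]; simp
  let v : κ → EuclideanSpace ℂ κ := fun i =>
    (((Real.sqrt (d i))⁻¹ : ℝ) : ℂ) • WithLp.toLp 2 (fun j => star (B i j))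
  have hinner : ∀ i j, inner ℂ (v i) (v j) =
      (((Real.sqrt (d i))⁻¹ : ℝ) : ℂ) * (((Real.sqrt (d j))⁻¹ : ℝ) : ℂ) *
        (Matrix.diagonal (fun i => (d i : ℂ)) : Matrix κ κ ℂ) i j := by
    intro i j
    rw [← hBB]
    simp only [v, inner_smul_left, inner_smul_right, Matrix.mul_apply, PiLp.inner_apply]
    simp [mul_assoc, mul_comm]
  have hon : Orthonormal ℂ (Set.domRestrict {i | d i ≠ 0} v) := by
    rw [orthonormal_iff_ite]
    rintro ⟨i, hi⟩ ⟨j, hj⟩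
    simp only [Set.domRestrict_apply, hinner, Subtype.mk.injEq]
    by_cases hij : i = j
    · subst hij
      simp only [Matrix.diagonal_apply_eq, if_true]
      have : Real.sqrt (d i) ≠ 0 := (Real.sqrt_pos.2 (lt_of_le_of_ne (hd0 i) (Ne.symm hi))).ne'
      have h2 : (Real.sqrt (d i))⁻¹ * (Real.sqrt (d i))⁻¹ * d i = 1 := by
        nth_rewrite 3 [← Real.mul_self_sqrt (hd0 i)]
        field_simp
      exact_mod_cast h2
    · simp [hij, Matrix.diagonal_apply_ne]
  obtain ⟨q, hq⟩ := hon.exists_orthonormalBasis_extension_of_card_eq (by simp)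
  let Q : Matrix κ κ ℂ := Matrix.of fun i j => star (q i j)
  have hQQ : Q * Qᴴ = 1 := by
    ext i j
    have := orthonormal_iff_ite.1 q.orthonormal i j
    rw [PiLp.inner_apply] at this
    simp only [Matrix.mul_apply, Matrix.one_apply, ← this]
    simp [Q, mul_comm]
  have hQQ' : Qᴴ * Q = 1 := mul_eq_one_comm.1 hQQ
  have hBQ : B = Matrix.diagonal (fun i => ((Real.sqrt (d i) : ℝ) : ℂ)) * Q := by
    ext i j
    rw [Matrix.diagonal_mul]
    by_cases hi : d i = 0
    · have h0 : (B * Bᴴ) i i = 0 := by rw [hBB]; simp [hi]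
      have : ∑ j, ‖B i j‖ ^ 2 = 0 := by
        rw [Matrix.mul_apply] at h0
        have h1 : ∀ j, B i j * Bᴴ j i = ((‖B i j‖ ^ 2 : ℝ) : ℂ) := by
          intro j
          rw [Matrix.conjTranspose_apply]
          simpa using Complex.mul_conj' (B i j)
        simp only [h1] at h0
        exact_mod_cast h0
      have := (Finset.sum_eq_zero_iff_of_nonneg (fun _ _ => by positivity)).1 this j (by simp)
      simp [hi, pow_eq_zero_iff] at this ⊢
      exact this
    · have : Real.sqrt (d i) ≠ 0 := (Real.sqrt_pos.2 (lt_of_le_of_ne (hd0 i) (Ne.symm hi))).ne'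
      have h' : (Real.sqrt (d i) : ℂ) ≠ 0 := by exact_mod_cast this
      simp only [Q, Matrix.of_apply, hq i hi, v]
      simp [h']
  refine ⟨Qᴴ * Wᴴ, ?_, ?_⟩
  · rw [Matrix.mem_unitaryGroup_iff', Matrix.star_eq_conjTranspose]
    simp only [Matrix.conjTranspose_mul, Matrix.conjTranspose_conjTranspose]
    calc W * Q * (Qᴴ * Wᴴ) = W * (Q * Qᴴ) * Wᴴ := by simp only [Matrix.mul_assoc]
      _ = 1 := by rw [hQQ, Matrix.mul_one, hWW']
  · have : A * (Qᴴ * Wᴴ) = W * Matrix.diagonal (fun i => ((Real.sqrt (d i) : ℝ) : ℂ)) * Wᴴ := by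
      calc A * (Qᴴ * Wᴴ) = (W * Wᴴ) * A * (Qᴴ * Wᴴ) := by rw [hWW', Matrix.one_mul]
        _ = W * B * (Qᴴ * Wᴴ) := by simp only [hB, Matrix.mul_assoc]
        _ = W * Matrix.diagonal (fun i => ((Real.sqrt (d i) : ℝ) : ℂ)) * (Q * Qᴴ) * Wᴴ := by
          rw [hBQ]; simp only [Matrix.mul_assoc]
        _ = _ := by rw [hQQ, Matrix.mul_one]
    rw [this]
    apply Matrix.isHermitian_mul_mul_conjTranspose
    rw [Matrix.isHermitian_diagonal_iff]
    intro i
    simp [IsSelfAdjoint]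

section
variable {m : Type*} [Fintype m] {p : m → Prop} [DecidablePred p]

lemma sum_nonneg_of_antisymm_pairs (w : m → {l // p l} → ℝ)
    (hout : ∀ l j, ¬ p l → 0 ≤ w l j)
    (hin : ∀ l j : {l // p l}, 0 ≤ w l j + w j l) :
    0 ≤ ∑ j, ∑ l, w l j := by
  have hsplit : ∀ j, ∑ l, w l j = ∑ l : {l // p l}, w l j + ∑ l : {l // ¬ p l}, w l j :=
    fun j => (Fintype.sum_subtype_add_sum_subtype p (fun l => w l j)).symm
  simp only [hsplit, Finset.sum_add_distrib]
  have h1 : 0 ≤ ∑ j : {l // p l}, ∑ l : {l // p l}, w l j := by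
    have h2 : ∑ j : {l // p l}, ∑ l : {l // p l}, w l j
        = ∑ j : {l // p l}, ∑ l : {l // p l}, w j l := Finset.sum_comm
    have h3 : 0 ≤ ∑ j : {l // p l}, ∑ l : {l // p l}, (w l j + w j l) :=
      Finset.sum_nonneg fun j _ => Finset.sum_nonneg fun l _ => hin l j
    simp only [Finset.sum_add_distrib] at h3
    linarith
  have h4 : 0 ≤ ∑ j : {l // p l}, ∑ l : {l // ¬ p l}, w l j :=
    Finset.sum_nonneg fun j _ => Finset.sum_nonneg fun l _ => hout l j l.2
  linarith

/-- If `√z_l G_{lj}` has symmetric moduli on the block `p × p` and `z` is larger on `p` than off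
it, then moving the weight `z` from rows to columns increases the weighted square sum. -/
lemma sum_row_weight_le_col_weight {z : m → ℝ} {G : m → {l // p l} → ℂ} (hz : ∀ l, 0 ≤ z l)
    (hzp : ∀ l j, p j → ¬ p l → z l ≤ z j)
    (hG : ∀ l j : {l // p l}, z l * ‖G l j‖ ^ 2 = z j * ‖G j l‖ ^ 2) :
    ∑ j, ∑ l, z l * ‖G l j‖ ^ 2 ≤ ∑ j : {l // p l}, z j * ∑ l, ‖G l j‖ ^ 2 := by
  have := sum_nonneg_of_antisymm_pairs (p := p) (fun l j => (z j - z l) * ‖G l j‖ ^ 2)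
    (fun l j hl => mul_nonneg (sub_nonneg.2 (hzp l j j.2 hl)) (by positivity)) ?_
  · simp only [sub_mul, Finset.sum_sub_distrib] at this
    simp only [Finset.mul_sum]
    linarith
  · intro l j
    have h := hG l j
    by_cases h0 : z l = 0 ∧ z j = 0
    · rw [h0.1, h0.2]; simp
    have hlj : 0 < z l + z j := by
      rcases (hz l).lt_or_eq with h1 | h1
      · linarith [hz j]
      rcases (hz j).lt_or_eq with h2 | h2
      · linarith
      exact absurd ⟨h1.symm, h2.symm⟩ h0
    have : 0 ≤ (z l + z j) * ((z j - z l) * ‖G l j‖ ^ 2 + (z l - z j) * ‖G j l‖ ^ 2) := by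
      have e : (z l + z j) * ((z j - z l) * ‖G l j‖ ^ 2 + (z l - z j) * ‖G j l‖ ^ 2)
          = (z j - z l) ^ 2 * (‖G l j‖ ^ 2 + ‖G j l‖ ^ 2) := by
        linear_combination 2 * (z j - z l) * h
      rw [e]; positivity
    exact nonneg_of_mul_nonneg_right this hlj

lemma two_mul_sum_row_weight_le {z : m → ℝ} {G Y : m → {l // p l} → ℂ} (hz : ∀ l, 0 ≤ z l)
    (hzp : ∀ l j, p j → ¬ p l → z l ≤ z j)
    (hG : ∀ l j : {l // p l}, z l * ‖G l j‖ ^ 2 = z j * ‖G j l‖ ^ 2) :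
    2 * ∑ j, ∑ l, z l * ‖G l j‖ ^ 2 ≤
      ∑ j : {l // p l}, ∑ l, (z j * ‖2 * G l j - Y l j‖ ^ 2 + z l * ‖Y l j‖ ^ 2) := by
  have h1 := sum_nonneg_of_antisymm_pairs (p := p)
    (fun l j => z l * ((z j - z l) / (z j + z l)) * ‖G l j‖ ^ 2)
    (fun l j hl => by
      have := sub_nonneg.2 (hzp l j j.2 hl)
      have := hz l
      have := hz j
      positivity) ?_
  · have h2 : ∀ j : {l // p l}, ∀ l, 2 * (z l * ‖G l j‖ ^ 2) +
        2 * (z l * ((z j - z l) / (z j + z l)) * ‖G l j‖ ^ 2) ≤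
        z j * ‖2 * G l j - Y l j‖ ^ 2 + z l * ‖Y l j‖ ^ 2 := by
      intro j l
      have hl := hz l
      have hj := hz j
      by_cases h0 : z j + z l = 0
      · have e1 : z l = 0 := by linarith
        have e2 : z j = 0 := by linarith
        simp [e1, e2]
      have hpos : 0 < z j + z l := lt_of_le_of_ne (by linarith) (Ne.symm h0)
      have hns : ∀ u v : ℂ, (z j + z l) * (z j * ‖2 * u - v‖ ^ 2 + z l * ‖v‖ ^ 2) =
          4 * z j * z l * ‖u‖ ^ 2 + ‖2 * (z j : ℂ) * u - (z j + z l) * v‖ ^ 2 := by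
        intro u v
        simp only [← Complex.normSq_eq_norm_sq, Complex.normSq_apply]
        simp
        ring
      have h3 : 2 * (z l * ‖G l j‖ ^ 2) +
        2 * (z l * ((z j - z l) / (z j + z l)) * ‖G l j‖ ^ 2) =
          4 * z j * z l * ‖G l j‖ ^ 2 / (z j + z l) := by
        field_simp; ring
      rw [h3, div_le_iff₀ hpos, mul_comm _ (z j + z l), hns]
      have : 0 ≤ ‖2 * (z j : ℂ) * G l j - (z j + z l) * Y l j‖ ^ 2 := by positivity
      linarith
    have h4 := Finset.sum_le_sum fun j (_ : j ∈ (Finset.univ : Finset {l // p l})) =>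
      Finset.sum_le_sum fun l (_ : l ∈ (Finset.univ : Finset m)) => h2 j l
    simp only [Finset.sum_add_distrib, ← Finset.mul_sum] at h4 ⊢
    linarith
  · intro l j
    have h := hG l j
    have e : z l * ((z j - z l) / (z j + z l)) * ‖G l j‖ ^ 2 +
        z j * ((z l - z j) / (z l + z j)) * ‖G j l‖ ^ 2 = 0 := by
      rw [add_comm (z l) (z j), div_eq_mul_inv, div_eq_mul_inv]
      linear_combination (z j - z l) * (z j + z l)⁻¹ * h
    exact e.ge
end

/-- The real part of the `j`-th diagonal entry of `Vᴴ M V`. -/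
noncomputable def compDiag {m κ : Type*} [Fintype m] (M : Matrix m m ℂ) (V : Matrix m κ ℂ)
    (j : κ) : ℝ := ((Vᴴ * M * V) j j).re

section
variable {m κ : Type*} [Fintype m]

lemma compDiag_add (M M' : Matrix m m ℂ) (V : Matrix m κ ℂ) (j : κ) :
    compDiag (M + M') V j = compDiag M V j + compDiag M' V j := by
  simp [compDiag, Matrix.mul_add, Matrix.add_mul]

lemma compDiag_sub (M M' : Matrix m m ℂ) (V : Matrix m κ ℂ) (j : κ) :
    compDiag (M - M') V j = compDiag M V j - compDiag M' V j := by
  simp [compDiag, Matrix.mul_sub, Matrix.sub_mul]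

lemma compDiag_smul (r : ℝ) (M : Matrix m m ℂ) (V : Matrix m κ ℂ) (j : κ) :
    compDiag (r • M) V j = r * compDiag M V j := by
  simp [compDiag]

lemma compDiag_one [DecidableEq m] [DecidableEq κ] {V : Matrix m κ ℂ} (hV : Vᴴ * V = 1) (j : κ) :
    compDiag 1 V j = 1 := by
  simp [compDiag, hV]

lemma compDiag_conj_mul {l : Type*} [Fintype l] (A : Matrix m l ℂ) (M : Matrix m m ℂ)
    (V : Matrix l κ ℂ) (j : κ) : compDiag (Aᴴ * M * A) V j = compDiag M (A * V) j := by
  simp [compDiag, Matrix.conjTranspose_mul, Matrix.mul_assoc]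

lemma sum_compDiag_mul_unitary [Fintype κ] [DecidableEq κ] (M : Matrix m m ℂ) (V : Matrix m κ ℂ)
    {U : Matrix κ κ ℂ} (hU : U ∈ Matrix.unitaryGroup κ ℂ) :
    ∑ j, compDiag M (V * U) j = ∑ j, compDiag M V j := by
  have h : ∀ W : Matrix m κ ℂ, ∑ j, compDiag M W j = (Wᴴ * M * W).trace.re := by
    intro W; simp [compDiag, Matrix.trace]
  rw [h, h, Matrix.conjTranspose_mul]
  have : Uᴴ * Vᴴ * M * (V * U) = Uᴴ * (Vᴴ * M * V) * U := by simp only [Matrix.mul_assoc]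
  rw [this, Matrix.trace_mul_comm, ← Matrix.mul_assoc]
  have hU' : U * Uᴴ = 1 := Matrix.mem_unitaryGroup_iff.1 hU
  rw [hU', Matrix.one_mul]

lemma compDiag_diagonal [DecidableEq m] (d : m → ℝ) (V : Matrix m κ ℂ) (j : κ) :
    compDiag (Matrix.diagonal fun i => (d i : ℂ)) V j = ∑ i, d i * ‖V i j‖ ^ 2 := by
  rw [compDiag, Matrix.mul_assoc, Matrix.mul_apply, Complex.re_sum]
  refine Finset.sum_congr rfl fun i _ => ?_
  rw [Matrix.diagonal_mul, Matrix.conjTranspose_apply, ← Complex.normSq_eq_norm_sq,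
    Complex.normSq_apply]
  simp
  ring

lemma compDiag_eq_sum [DecidableEq m] {M U : Matrix m m ℂ} {d : m → ℝ}
    (hM : M = U * Matrix.diagonal (fun i => (d i : ℂ)) * Uᴴ) (V : Matrix m κ ℂ) (j : κ) :
    compDiag M V j = ∑ i, d i * ‖(Uᴴ * V) i j‖ ^ 2 := by
  rw [← compDiag_diagonal, ← compDiag_conj_mul, hM, Matrix.conjTranspose_conjTranspose]

lemma sum_norm_sq_col [DecidableEq m] [DecidableEq κ] {U : Matrix m m ℂ}
    (hU : U ∈ Matrix.unitaryGroup m ℂ)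
    (V : Matrix m κ ℂ) (j : κ) : ∑ i, ‖(Uᴴ * V) i j‖ ^ 2 = compDiag 1 V j := by
  have hU' : U * Uᴴ = 1 := Matrix.mem_unitaryGroup_iff.1 hU
  rw [compDiag_eq_sum (M := 1) (U := U) (d := fun _ => 1)]
  · simp
  · simp [hU']
end

section
variable {n : ℕ} {y : Matrix (Fin n) (Fin n) ℂ}

lemma psdPow_eq (hy : y.PosSemidef) : ∃ U ∈ Matrix.unitaryGroup (Fin n) ℂ, ∃ η : Fin n → ℝ,
    (∀ i, 0 ≤ η i) ∧ y = U * Matrix.diagonal (fun i => (η i : ℂ)) * Uᴴ ∧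
    ∀ s : ℝ, psdPow y s = U * Matrix.diagonal (fun i => ((η i ^ s : ℝ) : ℂ)) * Uᴴ := by
  refine ⟨_, hy.1.eigenvectorUnitary.2, hy.1.eigenvalues, hy.eigenvalues_nonneg, ?_, fun s => ?_⟩
  · have h := hy.1.spectral_theorem
    rw [Unitary.conjStarAlgAut_apply] at h
    exact h
  · rw [psdPow, dif_pos hy.1]

lemma psdPow_isHermitian (hy : y.PosSemidef) (s : ℝ) : (psdPow y s).IsHermitian := by
  obtain ⟨U, -, η, -, -, h⟩ := psdPow_eq hy
  rw [h]
  apply Matrix.isHermitian_mul_mul_conjTranspose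
  rw [Matrix.isHermitian_diagonal_iff]
  intro i
  simp [IsSelfAdjoint]

lemma psdPow_mul_psdPow (hy : y.PosSemidef) {s t : ℝ} (hs : 0 ≤ s) (ht : 0 ≤ t) :
    psdPow y s * psdPow y t = psdPow y (s + t) := by
  obtain ⟨U, hU, η, hη, -, h⟩ := psdPow_eq hy
  have hU' : Uᴴ * U = 1 := Matrix.mem_unitaryGroup_iff'.1 hU
  rw [h, h, h]
  calc _ = U * Matrix.diagonal (fun i => ((η i ^ s : ℝ) : ℂ)) * (Uᴴ * U) *
        Matrix.diagonal (fun i => ((η i ^ t : ℝ) : ℂ)) * Uᴴ := by simp only [Matrix.mul_assoc]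
    _ = U * (Matrix.diagonal (fun i => ((η i ^ s : ℝ) : ℂ)) *
        Matrix.diagonal (fun i => ((η i ^ t : ℝ) : ℂ))) * Uᴴ := by
      rw [hU']; simp only [Matrix.mul_assoc, Matrix.one_mul]
    _ = _ := by
      rw [Matrix.diagonal_mul_diagonal]
      congr 3
      funext i
      rw [Real.rpow_add_of_nonneg (hη i) hs ht, Complex.ofReal_mul]

lemma psdPow_one (hy : y.PosSemidef) : psdPow y 1 = y := by
  obtain ⟨U, hU, η, hη, h', h⟩ := psdPow_eq hy
  rw [h, h']; simp

lemma psdPow_posSemidef (hy : y.PosSemidef) (s : ℝ) : (psdPow y s).PosSemidef := by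
  obtain ⟨U, -, η, hη, -, h⟩ := psdPow_eq hy
  rw [h]
  apply Matrix.PosSemidef.mul_mul_conjTranspose_same
  rw [Matrix.posSemidef_diagonal_iff]
  intro i
  have := Real.rpow_nonneg (hη i) s
  exact_mod_cast this

variable {κ : Type*} [DecidableEq κ]

/-- A scalar inequality between four powers passes to the quadratic form of a unit vector. -/
lemma compDiag_psdPow_inequality (hy : y.PosSemidef) {V : Matrix (Fin n) κ ℂ} (hV : Vᴴ * V = 1)
    {c₀ c₁ c₂ c₃ s₁ s₂ s₃ : ℝ}
    (h : ∀ η : ℝ, 0 ≤ η → 0 ≤ c₀ + c₁ * η ^ s₁ + c₂ * η ^ s₂ + c₃ * η ^ s₃) (j : κ) :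
    0 ≤ c₀ + c₁ * compDiag (psdPow y s₁) V j + c₂ * compDiag (psdPow y s₂) V j +
      c₃ * compDiag (psdPow y s₃) V j := by
  obtain ⟨U, hU, η, hη, -, hp⟩ := psdPow_eq hy
  have h1 := sum_norm_sq_col hU V j
  rw [compDiag_one hV] at h1
  have e : c₀ + c₁ * compDiag (psdPow y s₁) V j + c₂ * compDiag (psdPow y s₂) V j +
      c₃ * compDiag (psdPow y s₃) V j =
      ∑ i, (c₀ + c₁ * η i ^ s₁ + c₂ * η i ^ s₂ + c₃ * η i ^ s₃) * ‖(Uᴴ * V) i j‖ ^ 2 := by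
    rw [compDiag_eq_sum (hp s₁), compDiag_eq_sum (hp s₂), compDiag_eq_sum (hp s₃)]
    simp only [add_mul, Finset.sum_add_distrib, ← Finset.mul_sum, mul_assoc, h1, mul_one]
  rw [e]
  exact Finset.sum_nonneg fun i _ => mul_nonneg (h _ (hη i)) (by positivity)

lemma compDiag_ge_young (hy : y.PosSemidef) {V : Matrix (Fin n) κ ℂ} (hV : Vᴴ * V = 1)
    {z b θ : ℝ} (hz : 0 ≤ z) (hθ0 : 0 ≤ θ) (hb : (1 + θ) * b = 1) (j : κ) :
    (1 + θ) * (z ^ θ * compDiag (psdPow y b) V j) ≤ compDiag y V j + θ * z ^ (1 + θ) := by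
  have := compDiag_psdPow_inequality hy hV (c₀ := θ * z ^ (1 + θ)) (c₁ := 1) (s₁ := 1)
    (c₂ := -((1 + θ) * z ^ θ)) (s₂ := b) (c₃ := 0) (s₃ := 0) (fun η hη => by
      have := young_power hz hη hθ0 hb
      rw [Real.rpow_one]
      linarith) j
  rw [psdPow_one hy] at this
  linarith

lemma compDiag_young_two_term (hy : y.PosSemidef) {V : Matrix (Fin n) κ ℂ} (hV : Vᴴ * V = 1)
    {z a b θ : ℝ} (hz : 0 ≤ z) (hb : 0 < b) (hθ0 : 0 ≤ θ) (hθ1 : θ ≤ 1) (hab : θ * b = 2 * a)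
    (j : κ) :
    (2 - θ) * (z * compDiag (psdPow y (2 * a)) V j) ≤ θ * (z ^ θ * compDiag (psdPow y b) V j) +
      2 * (1 - θ) * (z ^ (1 + θ / 2) * compDiag (psdPow y a) V j) := by
  have := compDiag_psdPow_inequality hy hV (c₀ := 0) (c₁ := θ * z ^ θ) (s₁ := b)
    (c₂ := 2 * (1 - θ) * z ^ (1 + θ / 2)) (s₂ := a) (c₃ := - ((2 - θ) * z)) (s₃ := 2 * a)
    (fun η hη => by
      have := young_two_term hz hη hb hθ0 hθ1 hab
      linarith) j
  linarith
end

section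
variable {n : ℕ} {y Z E : Matrix (Fin n) (Fin n) ℂ} {z : Fin n → ℝ} {p : Fin n → Prop}
  [DecidablePred p] {a b θ : ℝ}

lemma exists_frame_trace_bound (hy : y.PosSemidef) (hE : E ∈ Matrix.unitaryGroup (Fin n) ℂ)
    (hZ : Z = E * Matrix.diagonal (fun i => (z i : ℂ)) * Eᴴ) (hz : ∀ i, 0 ≤ z i)
    (hzp : ∀ l j, p j → ¬ p l → z l ≤ z j) (ha : 0 ≤ a) (hb : 0 < b) (hθ0 : 0 ≤ θ) (hθ1 : θ ≤ 1)
    (hab : θ * b = 2 * a) (V₀ : Matrix (Fin n) {l // p l} ℂ) (hV₀ : V₀ᴴ * V₀ = 1) :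
    ∃ U ∈ Matrix.unitaryGroup {l // p l} ℂ,
      ∑ j, compDiag (psdPow y a * Z * psdPow y a) (V₀ * U) j ≤
        θ * ∑ j : {l // p l}, z j ^ θ * compDiag (psdPow y b) (V₀ * U) j +
        (1 - θ) / 2 * (∑ j : {l // p l}, z j ^ (1 + θ) +
          ∑ j : {l // p l}, z j ^ θ * compDiag Z (V₀ * U) j) := by
  set f := psdPow y a with hf
  have hfH : fᴴ = f := psdPow_isHermitian hy a
  obtain ⟨U, hU, hsym⟩ := Matrix.exists_unitary_mul_isHermitian
    (Matrix.of fun l j : {l // p l} => ((Real.sqrt (z l) : ℝ) : ℂ) * (Eᴴ * f * V₀) l j)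
  refine ⟨U, hU, ?_⟩
  have hUU : Uᴴ * U = 1 := Matrix.mem_unitaryGroup_iff'.1 hU
  set V := V₀ * U with hVdef
  have hV : Vᴴ * V = 1 := by
    rw [hVdef, Matrix.conjTranspose_mul, Matrix.mul_assoc, ← Matrix.mul_assoc V₀ᴴ, hV₀,
      Matrix.one_mul, hUU]
  set G : Matrix (Fin n) {l // p l} ℂ := Eᴴ * (f * V) with hGdef
  set W : Matrix (Fin n) {l // p l} ℂ := Eᴴ * V with hWdef
  have hD : ∀ l j : {l // p l},
      ((Matrix.of fun l j : {l // p l} => ((Real.sqrt (z l) : ℝ) : ℂ) * (Eᴴ * f * V₀) l j) * U) l j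
        = ((Real.sqrt (z l) : ℝ) : ℂ) * G l j := by
    intro l j
    have : G = Eᴴ * f * V₀ * U := by simp only [hGdef, hVdef, Matrix.mul_assoc]
    rw [this, Matrix.mul_apply, Matrix.mul_apply, Finset.mul_sum]
    simp [mul_assoc]
  have hG : ∀ l j : {l // p l}, z l * ‖G l j‖ ^ 2 = z j * ‖G j l‖ ^ 2 := by
    intro l j
    have h1 := hsym.apply l j
    rw [hD, hD] at h1
    have h2 := congrArg (fun c => ‖c‖ ^ 2) h1
    simp only [norm_star, norm_mul, mul_pow, Complex.norm_real, Real.norm_eq_abs, sq_abs,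
      Real.sq_sqrt (hz _)] at h2
    exact h2.symm
  have hN : ∀ j, compDiag (f * Z * f) V j = ∑ l, z l * ‖G l j‖ ^ 2 := by
    intro j
    have : f * Z * f = fᴴ * Z * f := by rw [hfH]
    rw [this, compDiag_conj_mul, compDiag_eq_sum hZ]
  have hα : ∀ j, ∑ l, ‖G l j‖ ^ 2 = compDiag (psdPow y (2 * a)) V j := by
    intro j
    rw [hGdef, sum_norm_sq_col hE, ← compDiag_conj_mul, hfH, Matrix.mul_one, hf,
      psdPow_mul_psdPow hy ha ha, two_mul]
  have hζ : ∀ j, ∑ l, z l * ‖W l j‖ ^ 2 = compDiag Z V j := by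
    intro j
    rw [compDiag_eq_sum hZ]
  have hW : ∀ j, ∑ l, ‖W l j‖ ^ 2 = 1 := by
    intro j
    rw [hWdef, sum_norm_sq_col hE, compDiag_one hV]
  have hβ : ∀ j, ∑ l, (star (W l j) * G l j).re = compDiag f V j := by
    intro j
    have hE' : E * Eᴴ = 1 := Matrix.mem_unitaryGroup_iff.1 hE
    have : Vᴴ * f * V = Wᴴ * G := by
      rw [hWdef, hGdef, Matrix.conjTranspose_mul Eᴴ V, Matrix.conjTranspose_conjTranspose]
      calc Vᴴ * f * V = Vᴴ * (E * Eᴴ) * (f * V) := by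
            rw [hE', Matrix.mul_one, Matrix.mul_assoc]
        _ = _ := by simp only [Matrix.mul_assoc]
    rw [compDiag, this, Matrix.mul_apply, Complex.re_sum]
    rfl
  have h1 := sum_row_weight_le_col_weight (p := p) (G := fun l j => G l j) hz hzp hG
  have h2 := two_mul_sum_row_weight_le (p := p) (G := fun l j => G l j)
    (Y := fun l j => ((z j ^ (θ / 2) : ℝ) : ℂ) * W l j) hz hzp hG
  have hexp : ∀ j : {l // p l}, ∑ l, (z j * ‖2 * G l j - ((z j ^ (θ / 2) : ℝ) : ℂ) * W l j‖ ^ 2 +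
      z l * ‖((z j ^ (θ / 2) : ℝ) : ℂ) * W l j‖ ^ 2) =
      4 * (z j * compDiag (psdPow y (2 * a)) V j) - 4 * (z j ^ (1 + θ / 2) * compDiag f V j) +
        z j ^ (1 + θ) + z j ^ θ * compDiag Z V j := by
    intro j
    have hzj := hz j
    have e1 : z j ^ (1 + θ / 2) = z j * z j ^ (θ / 2) := by
      rw [Real.rpow_add_of_nonneg hzj (by norm_num) (by positivity), Real.rpow_one]
    have e2 : z j ^ θ = (z j ^ (θ / 2)) ^ 2 := by
      rw [sq, ← Real.rpow_add_of_nonneg hzj (by positivity) (by positivity), add_halves]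
    have e3 : z j ^ (1 + θ) = z j * (z j ^ (θ / 2)) ^ 2 := by
      rw [Real.rpow_add_of_nonneg hzj (by norm_num) hθ0, Real.rpow_one, e2]
    rw [← hα, ← hβ, ← hζ, e1, e2, e3]
    generalize z j ^ (θ / 2) = r
    have hns : ∀ u v : ℂ, ‖2 * u - (r : ℂ) * v‖ ^ 2 =
        4 * ‖u‖ ^ 2 - 4 * r * (star v * u).re + r ^ 2 * ‖v‖ ^ 2 := by
      intro u v
      simp only [← Complex.normSq_eq_norm_sq, Complex.normSq_apply]
      simp
      ring
    have hl : ∀ l, z j * ‖2 * G l j - (r : ℂ) * W l j‖ ^ 2 + z l * ‖(r : ℂ) * W l j‖ ^ 2 =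
        4 * z j * ‖G l j‖ ^ 2 - 4 * z j * r * (star (W l j) * G l j).re +
          z j * r ^ 2 * ‖W l j‖ ^ 2 + r ^ 2 * (z l * ‖W l j‖ ^ 2) := by
      intro l
      rw [hns, norm_mul, mul_pow, Complex.norm_real, Real.norm_eq_abs, sq_abs]
      ring
    simp only [hl, Finset.sum_add_distrib, Finset.sum_sub_distrib, ← Finset.mul_sum, hW]
    ring
  have h3 : ∀ j : {l // p l}, _ := fun j =>
    compDiag_young_two_term hy hV (hz j) hb hθ0 hθ1 hab j
  have h4 := Finset.sum_le_sum fun j (_ : j ∈ (Finset.univ : Finset {l // p l})) => h3 j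
  simp only [hexp] at h2
  simp only [hα] at h1
  simp only [hN]
  rw [← hf] at h4
  simp only [Finset.sum_add_distrib, Finset.sum_sub_distrib, ← Finset.mul_sum] at h1 h2 h4 ⊢
  linarith [mul_le_mul_of_nonneg_left h1 hθ0,
    mul_le_mul_of_nonneg_left h2 (by linarith : 0 ≤ (1 - θ) / 2)]
end

section
variable {n : ℕ} {x y Z E : Matrix (Fin n) (Fin n) ℂ} {z : Fin n → ℝ} {p : Fin n → Prop}
  [DecidablePred p] {a b θ : ℝ}

lemma sum_compDiag_ge_young (hy : y.PosSemidef) (hz : ∀ i, 0 ≤ z i) (hθ0 : 0 ≤ θ)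
    (hb : (1 + θ) * b = 1) {V : Matrix (Fin n) {l // p l} ℂ} (hV : Vᴴ * V = 1) :
    (1 + θ) * ∑ j : {l // p l}, z j ^ θ * compDiag (psdPow y b) V j ≤
      ∑ j, compDiag y V j + θ * ∑ j : {l // p l}, z j ^ (1 + θ) := by
  rw [Finset.mul_sum, Finset.mul_sum, ← Finset.sum_add_distrib]
  exact Finset.sum_le_sum fun j _ => compDiag_ge_young hy hV (hz j) hθ0 hb j

lemma compDiag_midpoint {κ : Type*} {X Y : Matrix (Fin n) (Fin n) ℂ} (h : X + Y = (2 : ℝ) • Z)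
    (V : Matrix (Fin n) κ ℂ) (j : κ) :
    compDiag Z V j = (compDiag X V j + compDiag Y V j) / 2 := by
  rw [← compDiag_add, h, compDiag_smul]
  ring

lemma sum_compDiag_mul_psdPow_mul (hy : y.PosSemidef) (ha : 0 ≤ a) (hb : 0 ≤ b)
    (hab : 2 * a + b = 1) {X : Matrix (Fin n) (Fin n) ℂ} (h : X + psdPow y b = (2 : ℝ) • Z)
    {κ : Type*} [Fintype κ] (V : Matrix (Fin n) κ ℂ) :
    ∑ j, compDiag (psdPow y a * X * psdPow y a) V j =
      2 * ∑ j, compDiag (psdPow y a * Z * psdPow y a) V j - ∑ j, compDiag y V j := by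
  have h1 : psdPow y a * psdPow y b * psdPow y a = y := by
    rw [psdPow_mul_psdPow hy ha hb, psdPow_mul_psdPow hy (by positivity) ha,
      show a + b + a = 1 by linarith, psdPow_one hy]
  have h2 : psdPow y a * X * psdPow y a = (2 : ℝ) • (psdPow y a * Z * psdPow y a) - y := by
    rw [← Matrix.smul_mul, ← Matrix.mul_smul, ← h, Matrix.mul_add, Matrix.add_mul, h1]
    abel
  simp only [h2, compDiag_sub, compDiag_smul, Finset.sum_sub_distrib, Finset.mul_sum]

lemma sum_compDiag_sandwich_le (hx : x.PosSemidef) (hy : y.PosSemidef)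
    (hE : E ∈ Matrix.unitaryGroup (Fin n) ℂ)
    (hZ : Z = E * Matrix.diagonal (fun i => (z i : ℂ)) * Eᴴ) (hz : ∀ i, 0 ≤ z i)
    (hzp : ∀ l j, p j → ¬ p l → z l ≤ z j) (ha : 0 ≤ a) (hb : 0 < b) (hθ0 : 0 ≤ θ) (hθ1 : θ ≤ 1)
    (hab : θ * b = 2 * a) (hab1 : 2 * a + b = 1) (hXY : psdPow x b + psdPow y b = (2 : ℝ) • Z)
    {V : Matrix (Fin n) {l // p l} ℂ} (hV : Vᴴ * V = 1) :
    ∑ j, compDiag (psdPow y a * psdPow x b * psdPow y a +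
      psdPow x a * psdPow y b * psdPow x a) V j ≤ ∑ j : {l // p l}, 2 * z j ^ (1 + θ) := by
  have hframe : ∀ {U}, U ∈ Matrix.unitaryGroup {l // p l} ℂ → (V * U)ᴴ * (V * U) = 1 := by
    intro U hU
    have hUU : Uᴴ * U = 1 := Matrix.mem_unitaryGroup_iff'.1 hU
    rw [Matrix.conjTranspose_mul, Matrix.mul_assoc, ← Matrix.mul_assoc Vᴴ, hV, Matrix.one_mul, hUU]
  have hb1 : (1 + θ) * b = 1 := by linarith
  have hYX : psdPow y b + psdPow x b = (2 : ℝ) • Z := by rw [add_comm, hXY]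
  obtain ⟨U₁, hU₁, h₁⟩ := exists_frame_trace_bound hy hE hZ hz hzp ha hb hθ0 hθ1 hab V hV
  obtain ⟨U₂, hU₂, h₂⟩ := exists_frame_trace_bound hx hE hZ hz hzp ha hb hθ0 hθ1 hab V hV
  have y₁ := sum_compDiag_ge_young hy hz hθ0 hb1 (hframe hU₁)
  have y₂ := sum_compDiag_ge_young hy hz hθ0 hb1 (hframe hU₂)
  have x₁ := sum_compDiag_ge_young hx hz hθ0 hb1 (hframe hU₁)
  have x₂ := sum_compDiag_ge_young hx hz hθ0 hb1 (hframe hU₂)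
  rw [sum_compDiag_mul_unitary _ _ hU₁] at h₁ y₁ x₁
  rw [sum_compDiag_mul_unitary _ _ hU₂] at h₂ y₂ x₂
  have hmid : ∀ W : Matrix (Fin n) {l // p l} ℂ, ∑ j : {l // p l}, z j ^ θ * compDiag Z W j =
      (∑ j : {l // p l}, z j ^ θ * compDiag (psdPow x b) W j +
        ∑ j : {l // p l}, z j ^ θ * compDiag (psdPow y b) W j) / 2 := by
    intro W
    simp only [compDiag_midpoint hXY, mul_div_assoc', ← Finset.sum_div, mul_add,
      Finset.sum_add_distrib]
  rw [hmid] at h₁ h₂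
  simp only [compDiag_add, Finset.sum_add_distrib]
  rw [sum_compDiag_mul_psdPow_mul hy ha hb.le hab1 hXY,
    sum_compDiag_mul_psdPow_mul hx ha hb.le hab1 hYX, ← Finset.mul_sum]
  generalize ∑ j : {l // p l}, z j ^ (1 + θ) = B at *
  generalize ∑ j : {l // p l}, z j ^ θ * compDiag (psdPow x b) (V * U₁) j = X₁ at *
  generalize ∑ j : {l // p l}, z j ^ θ * compDiag (psdPow x b) (V * U₂) j = X₂ at *
  generalize ∑ j : {l // p l}, z j ^ θ * compDiag (psdPow y b) (V * U₁) j = Y₁ at *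
  generalize ∑ j : {l // p l}, z j ^ θ * compDiag (psdPow y b) (V * U₂) j = Y₂ at *
  generalize ∑ j, compDiag y V j = ty at *
  generalize ∑ j, compDiag x V j = tx at *
  generalize ∑ j, compDiag (psdPow y a * Z * psdPow y a) V j = Ny at *
  generalize ∑ j, compDiag (psdPow x a * Z * psdPow x a) V j = Nx at *
  have hp : 0 < 1 + θ := by linarith
  have hm : 0 ≤ (1 - θ) / 2 := by linarith
  have hm3 : 0 ≤ (1 + 3 * θ) / 2 := by linarith
  refine le_of_mul_le_mul_left ?_ hp
  linarith [mul_le_mul_of_nonneg_left h₁ hp.le, mul_le_mul_of_nonneg_left h₂ hp.le,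
    mul_le_mul_of_nonneg_left y₁ hm3, mul_le_mul_of_nonneg_left y₂ hm,
    mul_le_mul_of_nonneg_left x₁ hm, mul_le_mul_of_nonneg_left x₂ hm3]

lemma compDiag_eigenframe (hE : E ∈ Matrix.unitaryGroup (Fin n) ℂ)
    (hZ : Z = E * Matrix.diagonal (fun i => (z i : ℂ)) * Eᴴ) (j : Fin n) :
    compDiag Z E j = z j := by
  have hE' : Eᴴ * E = 1 := Matrix.mem_unitaryGroup_iff'.1 hE
  rw [compDiag_eq_sum hZ, hE', Finset.sum_eq_single j]
  · simp
  · intro i _ hij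
    simp [Matrix.one_apply_ne hij]
  · simp

lemma le_compDiag_add_eigenframe (hx : x.PosSemidef) (hy : y.PosSemidef)
    (hE : E ∈ Matrix.unitaryGroup (Fin n) ℂ)
    (hZ : Z = E * Matrix.diagonal (fun i => (z i : ℂ)) * Eᴴ) (hz : ∀ i, 0 ≤ z i)
    (hθ0 : 0 ≤ θ) (hb : (1 + θ) * b = 1)
    (hXY : psdPow x b + psdPow y b = (2 : ℝ) • Z) (j : Fin n) :
    2 * z j ^ (1 + θ) ≤ compDiag (x + y) E j := by
  have hE' : Eᴴ * E = 1 := Matrix.mem_unitaryGroup_iff'.1 hE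
  have h1 := compDiag_ge_young hx hE' (hz j) hθ0 hb j
  have h2 := compDiag_ge_young hy hE' (hz j) hθ0 hb j
  have h3 := compDiag_midpoint hXY E j
  rw [compDiag_eigenframe hE hZ] at h3
  have h4 : z j ^ (1 + θ) = z j ^ θ * z j := by
    rw [add_comm, Real.rpow_add_of_nonneg (hz j) hθ0 (by norm_num), Real.rpow_one]
  have h5 : compDiag (psdPow x b) E j = 2 * z j - compDiag (psdPow y b) E j := by linarith
  rw [compDiag_add]
  rw [h5] at h1
  rw [h4] at h1 h2 ⊢
  linarith
end

lemma sum_mul_nonneg_of_partial_sums {n : ℕ} {w x : Fin n → ℝ} (hw : Antitone w)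
    (hw0 : ∀ i, 0 ≤ w i) (hx : ∀ k ≤ n, 0 ≤ ∑ i, if i.val < k then x i else 0) :
    0 ≤ ∑ i, w i * x i := by
  induction n with
  | zero => simp
  | succ n ih =>
    have h1 := ih (w := fun i => w i.castSucc - w (Fin.last n)) (x := fun i => x i.castSucc)
      (fun i j hij => sub_le_sub_right (hw (Fin.castSucc_le_castSucc_iff.2 hij)) _)
      (fun i => sub_nonneg.2 (hw (Fin.le_last _)))
      (fun k hk => by
        have := hx k (by lia)
        rw [Fin.sum_univ_castSucc] at this
        simpa [hk.not_gt] using this)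
    have h2 := hx (n + 1) le_rfl
    simp only [Fin.is_lt, if_true] at h2
    have h3 := mul_nonneg (hw0 (Fin.last n)) h2
    simp only [sub_mul, Finset.sum_sub_distrib, ← Finset.mul_sum] at h1
    rw [Fin.sum_univ_castSucc] at h3 ⊢
    linarith

section
variable {n : ℕ}

lemma Matrix.PosSemidef.exists_antitone_diagonalization {M : Matrix (Fin n) (Fin n) ℂ}
    (hM : M.PosSemidef) : ∃ U ∈ Matrix.unitaryGroup (Fin n) ℂ, ∃ d : Fin n → ℝ, Antitone d ∧
      (∀ i, 0 ≤ d i) ∧ M = U * Matrix.diagonal (fun i => (d i : ℂ)) * Uᴴ := by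
  set U : Matrix (Fin n) (Fin n) ℂ := (hM.1.eigenvectorUnitary : Matrix (Fin n) (Fin n) ℂ)
    with hU
  have hUU : Uᴴ * U = 1 := Matrix.mem_unitaryGroup_iff'.1 hM.1.eigenvectorUnitary.2
  set σ := Tuple.sort (fun i => - hM.1.eigenvalues i)
  refine ⟨U.submatrix id σ, ?_, fun i => hM.1.eigenvalues (σ i), ?_,
    fun i => hM.eigenvalues_nonneg _, ?_⟩
  · rw [Matrix.mem_unitaryGroup_iff', Matrix.star_eq_conjTranspose, Matrix.conjTranspose_submatrix]
    have := Matrix.submatrix_mul_equiv Uᴴ U σ (Equiv.refl _) σ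
    rw [hUU, Matrix.submatrix_one_equiv] at this
    exact this
  · intro i j hij
    have := Tuple.monotone_sort (fun i => - hM.1.eigenvalues i) hij
    simpa using this
  · have h := hM.1.spectral_theorem
    rw [Unitary.conjStarAlgAut_apply] at h
    change M = U * Matrix.diagonal (fun i => (hM.1.eigenvalues i : ℂ)) * Uᴴ at h
    have hd : Matrix.diagonal (fun i => (hM.1.eigenvalues (σ i) : ℂ)) =
        (Matrix.diagonal (fun i => (hM.1.eigenvalues i : ℂ))).submatrix σ σ := by
      rw [Matrix.submatrix_diagonal_equiv]; rfl
    rw [hd, Matrix.conjTranspose_submatrix, Matrix.submatrix_mul_equiv, Matrix.submatrix_mul_equiv,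
      ← h, Matrix.submatrix_id_id]

lemma signs_diagonal_mem_unitaryGroup (s : Fin n → ℤˣ) :
    Matrix.diagonal (fun i => ((s i : ℤ) : ℂ)) ∈ Matrix.unitaryGroup (Fin n) ℂ := by
  rw [Matrix.mem_unitaryGroup_iff, Matrix.star_eq_conjTranspose, Matrix.diagonal_conjTranspose,
    Matrix.diagonal_mul_diagonal, ← Matrix.diagonal_one]
  congr 1
  funext i
  rcases Int.units_eq_one_or (s i) with h | h <;> simp [h]

lemma sum_signs_mul_signs {i j : Fin n} (hij : i ≠ j) :
    ∑ s : Fin n → ℤˣ, (((s i : ℤ) : ℂ) * ((s j : ℤ) : ℂ)) = 0 := by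
  have h := Equiv.sum_comp (Equiv.mulRight (Pi.mulSingle i (-1) : Fin n → ℤˣ))
    (fun s : Fin n → ℤˣ => ((s i : ℤ) : ℂ) * ((s j : ℤ) : ℂ))
  simp only [Equiv.coe_mulRight, Pi.mul_apply, Pi.mulSingle_eq_same,
    Pi.mulSingle_eq_of_ne hij.symm] at h
  simp only [mul_one, Units.val_neg, mul_neg, Int.cast_neg, neg_mul,
    Finset.sum_neg_distrib] at h
  exact self_eq_neg.1 h.symm

lemma sum_signs_conj (M : Matrix (Fin n) (Fin n) ℂ) :
    ∑ s : Fin n → ℤˣ, Matrix.diagonal (fun i => ((s i : ℤ) : ℂ)) * M *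
      Matrix.diagonal (fun i => ((s i : ℤ) : ℂ)) =
    (Fintype.card (Fin n → ℤˣ) : ℂ) • Matrix.diagonal (fun i => M i i) := by
  ext i j
  rw [Matrix.sum_apply, Matrix.smul_apply]
  simp only [Matrix.mul_diagonal, Matrix.diagonal_mul]
  by_cases hij : i = j
  · subst hij
    have : ∀ s : Fin n → ℤˣ, ((s i : ℤ) : ℂ) * M i i * ((s i : ℤ) : ℂ) = M i i := by
      intro s
      rcases Int.units_eq_one_or (s i) with h | h <;> simp [h]
    simp only [this]
    simp
  · rw [Matrix.diagonal_apply_ne _ hij, smul_zero]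
    have : ∀ s : Fin n → ℤˣ, ((s i : ℤ) : ℂ) * M i j * ((s j : ℤ) : ℂ) =
        (((s i : ℤ) : ℂ) * ((s j : ℤ) : ℂ)) * M i j := fun s => by ring
    simp only [this, ← Finset.sum_mul, sum_signs_mul_signs hij, zero_mul]
end

section UnitarilyInvariant
variable {n : ℕ} {N : Matrix (Fin n) (Fin n) ℂ → ℝ}

lemma seminorm_nonneg
    (hN_add : ∀ A B, N (A + B) ≤ N A + N B)
    (hN_smul : ∀ (c : ℂ) A, N (c • A) = ‖c‖ * N A)
    (A : Matrix (Fin n) (Fin n) ℂ) : 0 ≤ N A := by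
  have h0 : N 0 = 0 := by simpa using hN_smul 0 0
  have h1 := hN_add A ((-1 : ℂ) • A)
  rw [hN_smul] at h1
  simp [h0] at h1
  exact h1

/-- Pinching to the diagonal does not increase a unitarily invariant norm. -/
lemma norm_diagonal_le
    (hN_add : ∀ A B, N (A + B) ≤ N A + N B)
    (hN_smul : ∀ (c : ℂ) A, N (c • A) = ‖c‖ * N A)
    (hN_unitary : ∀ (A U V : Matrix (Fin n) (Fin n) ℂ),
      U ∈ Matrix.unitaryGroup (Fin n) ℂ → V ∈ Matrix.unitaryGroup (Fin n) ℂ → N (U * A * V) = N A)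
    (M : Matrix (Fin n) (Fin n) ℂ) :
    N (Matrix.diagonal fun i => M i i) ≤ N M := by
  have h0 : N 0 = 0 := by simpa using hN_smul 0 0
  have h1 : N (∑ s : Fin n → ℤˣ, Matrix.diagonal (fun i => ((s i : ℤ) : ℂ)) * M *
      Matrix.diagonal (fun i => ((s i : ℤ) : ℂ))) ≤ ∑ _s : Fin n → ℤˣ, N M := by
    refine (Finset.le_sum_of_subadditive N h0.le hN_add _ _).trans (le_of_eq ?_)
    exact Finset.sum_congr rfl fun s _ => hN_unitary _ _ _ (signs_diagonal_mem_unitaryGroup s)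
      (signs_diagonal_mem_unitaryGroup s)
  rw [sum_signs_conj, hN_smul, Finset.sum_const, nsmul_eq_mul, Complex.norm_natCast,
    Finset.card_univ] at h1
  exact le_of_mul_le_mul_left h1 (by exact_mod_cast Fintype.card_pos)

lemma norm_diagonal_signed_perm
    (hN_unitary : ∀ (A U V : Matrix (Fin n) (Fin n) ℂ),
      U ∈ Matrix.unitaryGroup (Fin n) ℂ → V ∈ Matrix.unitaryGroup (Fin n) ℂ → N (U * A * V) = N A)
    (d : Fin n → ℝ) (s : Fin n → ℤˣ) (σ : Equiv.Perm (Fin n)) :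
    N (Matrix.diagonal fun i => (((s i : ℤ) * d (σ i) : ℝ) : ℂ)) =
      N (Matrix.diagonal fun i => (d i : ℂ)) := by
  have hperm : ∀ τ : Equiv.Perm (Fin n),
      (1 : Matrix (Fin n) (Fin n) ℂ).submatrix id τ ∈ Matrix.unitaryGroup (Fin n) ℂ := by
    intro τ
    rw [Matrix.mem_unitaryGroup_iff', Matrix.star_eq_conjTranspose, Matrix.conjTranspose_submatrix,
      Matrix.conjTranspose_one]
    have := Matrix.submatrix_mul_equiv (1 : Matrix (Fin n) (Fin n) ℂ) 1 τ (Equiv.refl _) τ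
    rw [Matrix.one_mul, Matrix.submatrix_one_equiv] at this
    exact this
  have hperm' : (1 : Matrix (Fin n) (Fin n) ℂ).submatrix σ id ∈ Matrix.unitaryGroup (Fin n) ℂ := by
    have := Unitary.star_mem (hperm σ)
    rwa [Matrix.star_eq_conjTranspose, Matrix.conjTranspose_submatrix,
      Matrix.conjTranspose_one] at this
  have h1 : Matrix.diagonal (fun i => (((s i : ℤ) * d (σ i) : ℝ) : ℂ)) =
      (Matrix.diagonal (fun i => ((s i : ℤ) : ℂ)) *
        (1 : Matrix (Fin n) (Fin n) ℂ).submatrix σ id) *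
        Matrix.diagonal (fun i => (d i : ℂ)) *
        (1 : Matrix (Fin n) (Fin n) ℂ).submatrix id σ := by
    have h2 : (1 : Matrix (Fin n) (Fin n) ℂ).submatrix σ id *
        Matrix.diagonal (fun i => (d i : ℂ)) * (1 : Matrix (Fin n) (Fin n) ℂ).submatrix id σ =
        Matrix.diagonal (fun i => (d (σ i) : ℂ)) := by
      have e1 := Matrix.submatrix_mul_equiv (1 : Matrix (Fin n) (Fin n) ℂ)
        (Matrix.diagonal (fun i => (d i : ℂ))) σ (Equiv.refl _) id
      have e2 := Matrix.submatrix_mul_equiv (Matrix.diagonal (fun i => (d i : ℂ)))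
        (1 : Matrix (Fin n) (Fin n) ℂ) σ (Equiv.refl _) σ
      simp only [Equiv.coe_refl, Matrix.one_mul, Matrix.mul_one, Matrix.submatrix_id_id] at e1 e2
      rw [e1, e2, Matrix.submatrix_diagonal_equiv]
      rfl
    rw [Matrix.mul_assoc (Matrix.diagonal (fun i => ((s i : ℤ) : ℂ))), Matrix.mul_assoc, h2,
      Matrix.diagonal_mul_diagonal]
    simp
  rw [h1]
  exact hN_unitary _ _ _ (mul_mem (signs_diagonal_mem_unitaryGroup s) hperm') (hperm σ)

/-- Fan dominance for diagonal matrices. -/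
lemma norm_diagonal_le_of_partial_sums
    (hN_add : ∀ A B, N (A + B) ≤ N A + N B)
    (hN_smul : ∀ (c : ℂ) A, N (c • A) = ‖c‖ * N A)
    (hN_unitary : ∀ (A U V : Matrix (Fin n) (Fin n) ℂ),
      U ∈ Matrix.unitaryGroup (Fin n) ℂ → V ∈ Matrix.unitaryGroup (Fin n) ℂ → N (U * A * V) = N A)
    {h d : Fin n → ℝ} (hh : Antitone h) (hh0 : ∀ i, 0 ≤ h i)
    (hd : ∀ k ≤ n, 0 ≤ ∑ i, if i.val < k then d i - h i else 0) :
    N (Matrix.diagonal fun i => (h i : ℂ)) ≤ N (Matrix.diagonal fun i => (d i : ℂ)) := by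
  set P : (Fin n → ℝ) → ℝ := fun u => N (Matrix.diagonal fun i => (u i : ℂ)) with hP
  have hP_smul : ∀ (c : ℝ) u, P (c • u) = |c| * P u := by
    intro c u
    have : Matrix.diagonal (fun i => ((c • u) i : ℂ)) =
        (c : ℂ) • Matrix.diagonal (fun i => (u i : ℂ)) := by
      rw [← Matrix.diagonal_smul]
      congr 1
      funext i
      simp
    simp only [hP, this, hN_smul, Complex.norm_real, Real.norm_eq_abs]
  have hP_add : ∀ u v, P (u + v) ≤ P u + P v := by
    intro u v
    have : Matrix.diagonal (fun i => ((u + v) i : ℂ)) =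
        Matrix.diagonal (fun i => (u i : ℂ)) + Matrix.diagonal (fun i => (v i : ℂ)) := by
      rw [Matrix.diagonal_add]
      simp
    simp only [hP, this]
    exact hN_add _ _
  have hP0 : ∀ u, 0 ≤ P u := fun u => seminorm_nonneg hN_add hN_smul _
  change P h ≤ P d
  by_cases hz : h = 0
  · have : P 0 = 0 := by simpa using hP_smul 0 0
    rw [hz, this]
    exact hP0 d
  obtain ⟨g, hg1, hg2⟩ := exists_extension_of_le_sublinear
    (LinearPMap.mkSpanSingleton (σ := RingHom.id ℝ) h (P h) hz) P
    (fun c hc u => by rw [hP_smul, abs_of_pos hc]) hP_add (by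
      rintro ⟨u, hu⟩
      obtain ⟨c, rfl⟩ := Submodule.mem_span_singleton.1 hu
      rw [LinearPMap.mkSpanSingleton'_apply, hP_smul]
      simp only [RingHom.id_apply, smul_eq_mul]
      exact mul_le_mul_of_nonneg_right (le_abs_self c) (hP0 h))
  have hgh : g h = P h := by
    exact (hg1 ⟨h, Submodule.mem_span_singleton_self h⟩).trans
      (LinearPMap.mkSpanSingleton_apply ℝ ℝ hz (P h))
  set φ : Fin n → ℝ := fun i => g (Pi.single i 1)
  have hgφ : ∀ u, g u = ∑ i, φ i * u i := by
    intro u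
    rw [LinearMap.pi_apply_eq_sum_univ g u]
    refine Finset.sum_congr rfl fun i _ => ?_
    rw [smul_eq_mul, mul_comm]
    congr 2
    funext j
    simp [Pi.single_apply, eq_comm]
  set σ := Tuple.sort (fun i => - |φ i|)
  set w : Fin n → ℝ := fun i => |φ (σ i)|
  have hw : Antitone w := by
    intro i j hij
    have := Tuple.monotone_sort (fun i => - |φ i|) hij
    simpa using this
  set s : Fin n → ℤˣ := fun i => if 0 ≤ φ i then 1 else -1
  have hs : ∀ i, φ i * (s i : ℤ) = |φ i| := by
    intro i
    by_cases hi : 0 ≤ φ i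
    · simp [s, hi, abs_of_nonneg hi]
    · simp [s, hi, abs_of_neg (not_le.1 hi)]
  have step1 : P h ≤ ∑ i, w i * h i := by
    rw [← hgh, hgφ]
    calc ∑ i, φ i * h i ≤ ∑ i, |φ i| * h i :=
          Finset.sum_le_sum fun i _ => mul_le_mul_of_nonneg_right (le_abs_self _) (hh0 i)
      _ = ∑ i, w (σ.symm i) * h i := by simp [w]
      _ ≤ ∑ i, w i * h i := Monovary.sum_comp_perm_mul_le_sum_mul (hw.monovary hh)
  have step2 : ∑ i, w i * h i ≤ ∑ i, w i * d i := by
    have := sum_mul_nonneg_of_partial_sums hw (fun i => abs_nonneg _) hd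
    simp only [mul_sub, Finset.sum_sub_distrib] at this
    linarith
  have step3 : ∑ i, w i * d i = g fun i => (s i : ℤ) * d (σ.symm i) := by
    rw [hgφ, ← Equiv.sum_comp σ fun i => φ i * ((s i : ℤ) * d (σ.symm i))]
    refine Finset.sum_congr rfl fun i _ => ?_
    rw [← mul_assoc, hs]
    simp [w]
  calc P h ≤ ∑ i, w i * d i := step1.trans step2
    _ ≤ P fun i => (s i : ℤ) * d (σ.symm i) := by rw [step3]; exact hg2 _
    _ = P d := norm_diagonal_signed_perm hN_unitary d s σ.symm

lemma norm_le_of_compDiag_bounds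
    (hN_add : ∀ A B, N (A + B) ≤ N A + N B)
    (hN_smul : ∀ (c : ℂ) A, N (c • A) = ‖c‖ * N A)
    (hN_unitary : ∀ (A U V : Matrix (Fin n) (Fin n) ℂ),
      U ∈ Matrix.unitaryGroup (Fin n) ℂ → V ∈ Matrix.unitaryGroup (Fin n) ℂ → N (U * A * V) = N A)
    {H S E : Matrix (Fin n) (Fin n) ℂ} {β : Fin n → ℝ}
    (hH : H.PosSemidef) (hS : S.IsHermitian) (hE : E ∈ Matrix.unitaryGroup (Fin n) ℂ)
    (hβ : ∀ j, β j ≤ compDiag S E j)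
    (hHβ : ∀ (k : ℕ) (V : Matrix (Fin n) {l : Fin n // l.val < k} ℂ), Vᴴ * V = 1 →
      ∑ j, compDiag H V j ≤ ∑ j : {l : Fin n // l.val < k}, β j) : N H ≤ N S := by
  obtain ⟨U, hU, h, hh, hh0, hHU⟩ := hH.exists_antitone_diagonalization
  have hUU : Uᴴ * U = 1 := Matrix.mem_unitaryGroup_iff'.1 hU
  have hNH : N H = N (Matrix.diagonal fun i => (h i : ℂ)) := by
    rw [hHU]
    exact hN_unitary _ _ _ hU (Unitary.star_mem hU)
  have hNS : N (Matrix.diagonal fun i => (compDiag S E i : ℂ)) ≤ N S := by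
    have h1 := norm_diagonal_le hN_add hN_smul hN_unitary (Eᴴ * S * E)
    rw [hN_unitary S Eᴴ E (Unitary.star_mem hE) hE] at h1
    have h2 : (Eᴴ * S * E).IsHermitian := Matrix.isHermitian_conjTranspose_mul_mul E hS
    have h3 : (fun i => (compDiag S E i : ℂ)) = fun i => (Eᴴ * S * E) i i := by
      funext i
      exact Complex.conj_eq_iff_re.1 (h2.apply i i)
    rw [h3]
    exact h1
  rw [hNH]
  refine (norm_diagonal_le_of_partial_sums hN_add hN_smul hN_unitary hh hh0 fun k _ => ?_).trans hNS
  have hsum : ∀ f : Fin n → ℝ, ∑ i, (if i.val < k then f i else 0) =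
      ∑ j : {l : Fin n // l.val < k}, f j := by
    intro f
    rw [← Finset.sum_filter]
    exact Finset.sum_subtype _ (by simp) f
  have hV : (U.submatrix id (Subtype.val : {l : Fin n // l.val < k} → Fin n))ᴴ *
      U.submatrix id (Subtype.val : {l : Fin n // l.val < k} → Fin n) = 1 := by
    have e := Matrix.submatrix_mul_equiv Uᴴ U (Subtype.val : {l : Fin n // l.val < k} → Fin n)
      (Equiv.refl _) (Subtype.val : {l : Fin n // l.val < k} → Fin n)
    rw [hUU, Matrix.submatrix_one _ Subtype.val_injective] at e
    exact e
  have h1 := hHβ k _ hV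
  have h2 : ∀ j : {l : Fin n // l.val < k}, compDiag H (U.submatrix id Subtype.val) j = h j :=
    fun j => compDiag_eigenframe hU hHU j
  rw [hsum]
  simp only [h2] at h1
  rw [Finset.sum_sub_distrib]
  have h3 : ∑ j : {l : Fin n // l.val < k}, β j ≤
      ∑ j : {l : Fin n // l.val < k}, compDiag S E j :=
    Finset.sum_le_sum fun j _ => hβ j
  linarith
end UnitarilyInvariant

theorem stmt1 {n : ℕ} (x y : Matrix (Fin n) (Fin n) ℂ)
    (hx : x.PosSemidef) (hy : y.PosSemidef)
    (N : Matrix (Fin n) (Fin n) ℂ → ℝ)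
    (hN_add : ∀ A B, N (A + B) ≤ N A + N B)
    (hN_smul : ∀ (c : ℂ) A, N (c • A) = ‖c‖ * N A)
    (hN_zero : ∀ A, N A = 0 ↔ A = 0)
    (hN_unitary : ∀ (A U V : Matrix (Fin n) (Fin n) ℂ),
      U ∈ Matrix.unitaryGroup (Fin n) ℂ → V ∈ Matrix.unitaryGroup (Fin n) ℂ →
      N (U * A * V) = N A)
    (t : ℝ) (ht : t ∈ Set.Icc (3/4 : ℝ) 1) :
    N (psdPow y (1 - t) * psdPow x (2*t - 1) * psdPow y (1 - t) +
        psdPow x (1 - t) * psdPow y (2*t - 1) * psdPow x (1 - t)) ≤ N (x + y) := by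
  obtain ⟨ht1, ht2⟩ := ht
  set a := 1 - t with ha
  set b := 2 * t - 1 with hb
  have ha0 : 0 ≤ a := by linarith
  have hb0 : 0 < b := by linarith
  have hab1 : 2 * a + b = 1 := by rw [ha, hb]; ring
  have hab : 2 * a / b * b = 2 * a := div_mul_cancel₀ _ hb0.ne'
  have hθ0 : 0 ≤ 2 * a / b := by positivity
  have hθ1 : 2 * a / b ≤ 1 := by rw [div_le_one hb0]; linarith
  have hHx := psdPow_isHermitian hx a
  have hHy := psdPow_isHermitian hy a
  have hZ : ((1 / 2 : ℝ) • (psdPow x b + psdPow y b)).PosSemidef :=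
    ((psdPow_posSemidef hx b).add (psdPow_posSemidef hy b)).smul (by norm_num)
  obtain ⟨E, hE, z, hz, hz0, hZE⟩ := hZ.exists_antitone_diagonalization
  have hXY : psdPow x b + psdPow y b = (2 : ℝ) • ((1 / 2 : ℝ) • (psdPow x b + psdPow y b)) := by
    rw [smul_smul]; norm_num
  refine norm_le_of_compDiag_bounds hN_add hN_smul hN_unitary
    (β := fun j => 2 * z j ^ (1 + 2 * a / b)) (E := E) ?_ (hx.add hy).1 hE
    (le_compDiag_add_eigenframe hx hy hE hZE hz0 hθ0 (by linarith) hXY) fun k V hV => ?_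
  · refine Matrix.PosSemidef.add ?_ ?_
    · have := (psdPow_posSemidef hx b).mul_mul_conjTranspose_same (psdPow y a)
      rwa [hHy.eq] at this
    · have := (psdPow_posSemidef hy b).mul_mul_conjTranspose_same (psdPow x a)
      rwa [hHx.eq] at this
  · exact sum_compDiag_sandwich_le hx hy hE hZE hz0
      (fun l j hj hl => hz (Fin.le_def.2 (by lia))) ha0 hb0 hθ0 hθ1 hab hab1 hXY hV
end

section
/- Let x, y ∈ M_n(ℂ) be positive semidefinite, let z ∈ M_n(ℂ), and let t ∈ [1/2, 1]. Set B_t = x^t z y^{1-t} + y^t z* x^{1-t} and F_t = y^{1-t} z* x^{2t-1} z y^{1-t} + x^{1-t} z y^{2t-1} z* x^{1-t}. Then the 2n×2n block matrix [[x+y, B_t], [B_t*, F_t]] is positive semidefinite. -/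
open scoped Matrix ComplexOrder

theorem conjTranspose_psdPow {N : ℕ} (A : Matrix (Fin N) (Fin N) ℂ) (s : ℝ) :
    (psdPow A s)ᴴ = psdPow A s := by
  unfold psdPow
  split_ifs with hA
  · have hD : (Matrix.diagonal fun i => ((hA.eigenvalues i ^ s : ℝ) : ℂ))ᴴ =
        Matrix.diagonal fun i => ((hA.eigenvalues i ^ s : ℝ) : ℂ) := by
      rw [Matrix.diagonal_conjTranspose]
      congr 1
      ext i
      exact Complex.conj_ofReal _
    rw [Matrix.conjTranspose_mul, Matrix.conjTranspose_mul, Matrix.conjTranspose_conjTranspose,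
      hD, Matrix.mul_assoc]
  · exact Matrix.conjTranspose_zero

theorem psdPow_one_s3 {N : ℕ} {A : Matrix (Fin N) (Fin N) ℂ} (hA : A.IsHermitian) :
    psdPow A 1 = A := by
  rw [psdPow, dif_pos hA]
  conv_rhs => rw [hA.spectral_theorem]
  simp [Unitary.conjStarAlgAut_apply, Matrix.star_eq_conjTranspose, Function.comp_def]

theorem psdPow_mul_psdPow_s3 {N : ℕ} {A : Matrix (Fin N) (Fin N) ℂ} (hA : A.PosSemidef)
    {r s : ℝ} (hr : 0 ≤ r) (hs : 0 ≤ s) :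
    psdPow A r * psdPow A s = psdPow A (r + s) := by
  have hH := hA.isHermitian
  have hU : (hH.eigenvectorUnitary : Matrix (Fin N) (Fin N) ℂ)ᴴ *
      (hH.eigenvectorUnitary : Matrix (Fin N) (Fin N) ℂ) = 1 :=
    Unitary.coe_star_mul_self hH.eigenvectorUnitary
  simp only [psdPow, dif_pos hH, Matrix.mul_assoc]
  rw [← Matrix.mul_assoc _ᴴ, hU, Matrix.one_mul, ← Matrix.mul_assoc (Matrix.diagonal _),
    Matrix.diagonal_mul_diagonal]
  simp only [Real.rpow_add_of_nonneg (hA.eigenvalues_nonneg _) hr hs, Complex.ofReal_mul]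

theorem posSemidef_fromBlocks_psdPow {n : ℕ} {x : Matrix (Fin n) (Fin n) ℂ}
    (hx : x.PosSemidef) (w : Matrix (Fin n) (Fin n) ℂ) {t : ℝ} (ht : 1 / 2 ≤ t) :
    (Matrix.fromBlocks x (psdPow x t * w) (psdPow x t * w)ᴴ
      (wᴴ * psdPow x (2 * t - 1) * w)).PosSemidef := by
  have hx_half : psdPow x (1 / 2) * psdPow x (1 / 2) = x := by
    rw [psdPow_mul_psdPow_s3 hx (by norm_num) (by norm_num), add_halves, psdPow_one_s3 hx.isHermitian]
  have hx_left : psdPow x (1 / 2) * psdPow x (t - 1 / 2) = psdPow x t := by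
    rw [psdPow_mul_psdPow_s3 hx (by norm_num) (by linarith), add_sub_cancel]
  have hx_right : psdPow x (t - 1 / 2) * psdPow x (1 / 2) = psdPow x t := by
    rw [psdPow_mul_psdPow_s3 hx (by linarith) (by norm_num), sub_add_cancel]
  have hx_sq : psdPow x (t - 1 / 2) * psdPow x (t - 1 / 2) = psdPow x (2 * t - 1) := by
    rw [psdPow_mul_psdPow_s3 hx (by linarith) (by linarith)]
    congr 1
    ring
  have key : Matrix.fromBlocks x (psdPow x t * w) (psdPow x t * w)ᴴ
      (wᴴ * psdPow x (2 * t - 1) * w) =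
      (Matrix.fromBlocks (psdPow x (1 / 2)) (psdPow x (t - 1 / 2) * w)
        (0 : Matrix (Fin n) (Fin n) ℂ) 0)ᴴ *
      Matrix.fromBlocks (psdPow x (1 / 2)) (psdPow x (t - 1 / 2) * w) 0 0 := by
    rw [Matrix.fromBlocks_conjTranspose, Matrix.fromBlocks_multiply]
    simp only [Matrix.conjTranspose_mul, conjTranspose_psdPow, Matrix.conjTranspose_zero,
      Matrix.zero_mul, add_zero]
    rw [hx_half, ← Matrix.mul_assoc (psdPow x (1 / 2)), hx_left,
      Matrix.mul_assoc wᴴ _ (psdPow x _), hx_right, ← hx_sq]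
    simp only [Matrix.mul_assoc]
  rw [key]
  exact Matrix.posSemidef_conjTranspose_mul_self _

theorem stmt3 {n : ℕ} (x y : Matrix (Fin n) (Fin n) ℂ)
    (hx : x.PosSemidef) (hy : y.PosSemidef)
    (z : Matrix (Fin n) (Fin n) ℂ)
    (t : ℝ) (ht : t ∈ Set.Icc (1/2 : ℝ) 1) :
    (Matrix.fromBlocks (x + y)
      (psdPow x t * z * psdPow y (1 - t) + psdPow y t * zᴴ * psdPow x (1 - t))
      (psdPow x t * z * psdPow y (1 - t) + psdPow y t * zᴴ * psdPow x (1 - t))ᴴ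
      (psdPow y (1 - t) * zᴴ * psdPow x (2*t - 1) * z * psdPow y (1 - t) +
      psdPow x (1 - t) * z * psdPow y (2*t - 1) * zᴴ * psdPow x (1 - t))).PosSemidef := by
  have hX := posSemidef_fromBlocks_psdPow hx (z * psdPow y (1 - t)) ht.1
  have hY := posSemidef_fromBlocks_psdPow hy (zᴴ * psdPow x (1 - t)) ht.1
  convert hX.add hY using 1
  rw [Matrix.fromBlocks_add]
  simp only [Matrix.conjTranspose_add, Matrix.conjTranspose_mul, conjTranspose_psdPow,
    Matrix.conjTranspose_conjTranspose, Matrix.mul_assoc]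
end

section
/- Let x, y ∈ M_n(ℂ) be positive semidefinite and let |||·||| be any unitarily invariant norm on M_n(ℂ). Then for every t ∈ (3/4, 1), |||y^{1-t} x^{2t-1} y^{1-t} + x^{1-t} y^{2t-1} x^{1-t}||| ≤ 2^{4(t - 3/4)} |||x + y|||. -/
open scoped Matrix ComplexOrder

theorem LinearMap.exists_orthonormalBasis_inner_eq_zero_of_lt (n : ℕ) :
    ∀ (E : Type) [NormedAddCommGroup E] [InnerProductSpace ℂ E] [FiniteDimensional ℂ E]
      (_ : Module.finrank ℂ E = n) (T : E →ₗ[ℂ] E),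
      ∃ b : OrthonormalBasis (Fin n) ℂ E, ∀ i j, i < j → inner ℂ (b i) (T (b j)) = 0 := by
  induction n with
  | zero =>
    intro E _ _ _ hE T
    exact ⟨(stdOrthonormalBasis ℂ E).reindex (finCongr hE), fun i => i.elim0⟩
  | succ n ih =>
    intro E _ _ _ hE T
    have : Nontrivial E := Module.nontrivial_of_finrank_pos (R := ℂ) (by omega)
    have : Fact (Module.finrank ℂ E = n + 1) := ⟨hE⟩
    obtain ⟨c, hc⟩ := Module.End.exists_eigenvalue (LinearMap.adjoint T)
    obtain ⟨w, hw⟩ := hc.exists_hasEigenvector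
    have hw0 : ‖w‖ ≠ 0 := norm_ne_zero_iff.2 hw.2
    obtain ⟨v, hv1, hvT⟩ : ∃ v : E, ‖v‖ = 1 ∧ LinearMap.adjoint T v = c • v := by
      refine ⟨((‖w‖ : ℂ)⁻¹) • w, ?_, ?_⟩
      · simp [norm_smul, hw0]
      · rw [map_smul, hw.apply_eq_smul, smul_comm]
    have hv0 : v ≠ 0 := fun h => by simp [h] at hv1
    have hinv : ∀ u ∈ (ℂ ∙ v)ᗮ, T u ∈ (ℂ ∙ v)ᗮ := by
      intro u hu
      rw [Submodule.mem_orthogonal_singleton_iff_inner_right] at hu ⊢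
      rw [← LinearMap.adjoint_inner_left, hvT, inner_smul_left, hu, mul_zero]
    obtain ⟨b, hb⟩ := ih (ℂ ∙ v)ᗮ (Submodule.finrank_orthogonal_span_singleton hv0)
      (T.restrict hinv)
    have hperp : ∀ u : (ℂ ∙ v)ᗮ, inner ℂ v (u : E) = 0 := fun u =>
      (Submodule.mem_orthogonal_singleton_iff_inner_right).1 u.2
    have hon : Orthonormal ℂ (Matrix.vecCons v fun i => (b i : E)) :=
      orthonormal_vecCons_iff.2 ⟨hv1, fun i => hperp _,
        b.orthonormal.comp_linearIsometry (ℂ ∙ v)ᗮ.subtypeₗᵢ⟩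
    have hcard : Fintype.card (Fin (n + 1)) = Module.finrank ℂ E := by simp [hE]
    refine ⟨OrthonormalBasis.mk hon
      (hon.linearIndependent.span_eq_top_of_card_eq_finrank' hcard).ge, ?_⟩
    intro i j hij
    simp only [OrthonormalBasis.coe_mk]
    cases j using Fin.cases with
    | zero => exact absurd hij (Fin.not_lt_zero i)
    | succ j =>
      cases i using Fin.cases with
      | zero => simpa using hperp ⟨_, hinv _ (b j).2⟩
      | succ i => simpa using hb i j (Fin.succ_lt_succ_iff.1 hij)

/-- **Schur triangularization**. -/
theorem Matrix.exists_unitary_isLowerTriangular {n : ℕ} (A : Matrix (Fin n) (Fin n) ℂ) :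
    ∃ U ∈ Matrix.unitaryGroup (Fin n) ℂ, (Uᴴ * A * U).IsLowerTriangular := by
  obtain ⟨b, hb⟩ := LinearMap.exists_orthonormalBasis_inner_eq_zero_of_lt n
    (EuclideanSpace ℂ (Fin n)) (by simp) (Matrix.toEuclideanLin A)
  refine ⟨(EuclideanSpace.basisFun (Fin n) ℂ).toBasis.toMatrix b,
    OrthonormalBasis.toMatrix_orthonormalBasis_mem_unitary _ _, ?_⟩
  intro i j hij
  rw [← hb i j hij]
  simp [Matrix.mul_apply, Module.Basis.toMatrix_apply, Matrix.mulVec, dotProduct,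
    EuclideanSpace.inner_eq_star_dotProduct, Finset.sum_mul]
  rw [Finset.sum_comm]
  refine Finset.sum_congr rfl fun k _ => Finset.sum_congr rfl fun l _ => by ring

theorem exists_perm_comp_eq_of_multiset_map_eq {ι α : Type*} [Fintype ι] [DecidableEq α]
    {f g : ι → α} (h : Finset.univ.val.map f = Finset.univ.val.map g) :
    ∃ σ : Equiv.Perm ι, g ∘ σ = f := by
  have hc : ∀ a, Nonempty ({i // f i = a} ≃ {i // g i = a}) := by
    intro a
    have := congrArg (Multiset.count a) h
    rw [Multiset.count_map, Multiset.count_map] at this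
    rw [← Fintype.card_eq, Fintype.card_subtype, Fintype.card_subtype, Finset.card, Finset.card]
    simpa [eq_comm] using this
  have e := fun a => (hc a).some
  refine ⟨(Equiv.sigmaFiberEquiv f).symm.trans
    ((Equiv.sigmaCongrRight e).trans (Equiv.sigmaFiberEquiv g)), ?_⟩
  ext i
  exact (e (f i) ⟨i, rfl⟩).2

/-- A norm on complex square matrices invariant under unitary multiplication on both sides. -/
structure IsUnitarilyInvariantNorm {n : ℕ} (N : Matrix (Fin n) (Fin n) ℂ → ℝ) : Prop where
  add_le : ∀ A B, N (A + B) ≤ N A + N B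
  smul : ∀ (c : ℂ) A, N (c • A) = ‖c‖ * N A
  eq_zero_iff : ∀ A, N A = 0 ↔ A = 0
  unitary : ∀ (A U V : Matrix (Fin n) (Fin n) ℂ),
    U ∈ Matrix.unitaryGroup (Fin n) ℂ → V ∈ Matrix.unitaryGroup (Fin n) ℂ → N (U * A * V) = N A

theorem Complex.exists_eq_half_add_of_norm_le_one {θ : ℂ} (h : ‖θ‖ ≤ 1) :
    ∃ u v : ℂ, ‖u‖ = 1 ∧ ‖v‖ = 1 ∧ θ = (1 / 2 : ℂ) * (u + v) := by
  refine ⟨Complex.exp ((θ.arg + Real.arccos ‖θ‖ : ℝ) * Complex.I),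
    Complex.exp ((θ.arg - Real.arccos ‖θ‖ : ℝ) * Complex.I),
    Complex.norm_exp_ofReal_mul_I _, Complex.norm_exp_ofReal_mul_I _, ?_⟩
  have hc : (‖θ‖ : ℂ) = Complex.cos (Real.arccos ‖θ‖ : ℝ) := by
    rw [← Complex.ofReal_cos, Real.cos_arccos (by linarith [norm_nonneg θ]) h]
  conv_lhs => rw [← Complex.norm_mul_exp_arg_mul_I θ, hc, Complex.cos]
  push_cast
  rw [add_mul, sub_mul, Complex.exp_add, sub_eq_add_neg, Complex.exp_add, neg_mul]
  ring

theorem Matrix.diagonal_mem_unitaryGroup {n : ℕ} {d : Fin n → ℂ} (h : ∀ i, ‖d i‖ = 1) :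
    Matrix.diagonal d ∈ Matrix.unitaryGroup (Fin n) ℂ := by
  rw [Matrix.mem_unitaryGroup_iff, Matrix.star_eq_conjTranspose, Matrix.diagonal_conjTranspose,
    Matrix.diagonal_mul_diagonal, ← Matrix.diagonal_one]
  congr 1
  ext i
  simp [Complex.mul_conj, Complex.normSq_eq_norm_sq, h i]

theorem Matrix.conjTranspose_mem_unitaryGroup {n : ℕ} {U : Matrix (Fin n) (Fin n) ℂ}
    (h : U ∈ Matrix.unitaryGroup (Fin n) ℂ) : Uᴴ ∈ Matrix.unitaryGroup (Fin n) ℂ :=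
  Unitary.star_mem h

theorem sum_signs_smul_diagonal_conj {n : ℕ} (A : Matrix (Fin n) (Fin n) ℂ) :
    ∑ ε : Fin n → ℤˣ, Matrix.diagonal (fun i => ((ε i : ℤ) : ℂ)) * A *
      Matrix.diagonal (fun i => ((ε i : ℤ) : ℂ)) =
    (Fintype.card (Fin n → ℤˣ) : ℂ) • Matrix.diagonal A.diag := by
  ext i j
  simp only [Matrix.sum_apply, Matrix.mul_diagonal, Matrix.diagonal_mul, Matrix.smul_apply]
  by_cases hij : i = j
  · subst hij
    have : ∀ ε : Fin n → ℤˣ, ((ε i : ℤ) : ℂ) * A i i * ((ε i : ℤ) : ℂ) = A i i := by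
      intro ε
      rcases Int.units_eq_one_or (ε i) with h | h <;> simp [h]
    simp [this]
  · rw [Matrix.diagonal_apply_ne _ hij, smul_zero]
    have := Fintype.sum_equiv (Equiv.mulLeft (Pi.mulSingle i (-1) : Fin n → ℤˣ))
      (fun ε => - (((ε i : ℤ) : ℂ) * A i j * ((ε j : ℤ) : ℂ)))
      (fun ε => ((ε i : ℤ) : ℂ) * A i j * ((ε j : ℤ) : ℂ)) (by
        intro ε
        simp [Pi.mulSingle_eq_of_ne (Ne.symm hij)])
    rw [Finset.sum_neg_distrib] at this
    exact self_eq_neg.1 this.symm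

namespace IsUnitarilyInvariantNorm

variable {n : ℕ} {N : Matrix (Fin n) (Fin n) ℂ → ℝ}

theorem nonneg (hN : IsUnitarilyInvariantNorm N) (A : Matrix (Fin n) (Fin n) ℂ) : 0 ≤ N A := by
  have h1 := hN.add_le A ((-1 : ℂ) • A)
  rw [hN.smul] at h1
  have h2 : N (A + (-1 : ℂ) • A) = 0 := (hN.eq_zero_iff _).2 (by simp)
  rw [h2, norm_neg, norm_one] at h1
  linarith

theorem sum_le (hN : IsUnitarilyInvariantNorm N) {ι : Type*} (s : Finset ι)
    (f : ι → Matrix (Fin n) (Fin n) ℂ) : N (∑ i ∈ s, f i) ≤ ∑ i ∈ s, N (f i) :=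
  Finset.le_sum_of_subadditive N ((hN.eq_zero_iff 0).2 rfl).le hN.add_le s f

theorem conj_eq (hN : IsUnitarilyInvariantNorm N) {U : Matrix (Fin n) (Fin n) ℂ}
    (hU : U ∈ Matrix.unitaryGroup (Fin n) ℂ) (A : Matrix (Fin n) (Fin n) ℂ) :
    N (Uᴴ * A * U) = N A :=
  hN.unitary _ _ _ (Matrix.conjTranspose_mem_unitaryGroup hU) hU

theorem half_add_le (hN : IsUnitarilyInvariantNorm N) {A B : Matrix (Fin n) (Fin n) ℂ} {r : ℝ}
    (hA : N A ≤ r) (hB : N B ≤ r) : N ((1 / 2 : ℂ) • (A + B)) ≤ r := by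
  rw [hN.smul]
  have := hN.add_le A B
  norm_num
  linarith

theorem diagonal_mul_mul_diagonal_le (hN : IsUnitarilyInvariantNorm N) {c d : Fin n → ℂ}
    (hc : ∀ i, ‖c i‖ ≤ 1) (hd : ∀ i, ‖d i‖ ≤ 1) (A : Matrix (Fin n) (Fin n) ℂ) :
    N (Matrix.diagonal c * A * Matrix.diagonal d) ≤ N A := by
  choose u v hu hv hcuv using fun i => Complex.exists_eq_half_add_of_norm_le_one (hc i)
  choose u' v' hu' hv' hduv using fun i => Complex.exists_eq_half_add_of_norm_le_one (hd i)
  have h1 : Matrix.diagonal c = (1 / 2 : ℂ) • (Matrix.diagonal u + Matrix.diagonal v) := by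
    rw [Matrix.diagonal_add, ← Matrix.diagonal_smul]
    exact congrArg _ (funext hcuv)
  have h2 : Matrix.diagonal d = (1 / 2 : ℂ) • (Matrix.diagonal u' + Matrix.diagonal v') := by
    rw [Matrix.diagonal_add, ← Matrix.diagonal_smul]
    exact congrArg _ (funext hduv)
  have key : ∀ w : Fin n → ℂ, (∀ i, ‖w i‖ = 1) →
      N (Matrix.diagonal w * A * Matrix.diagonal d) ≤ N A := by
    intro w hw
    rw [h2, Matrix.mul_smul, Matrix.mul_add]
    exact hN.half_add_le
      (hN.unitary _ _ _ (Matrix.diagonal_mem_unitaryGroup hw)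
        (Matrix.diagonal_mem_unitaryGroup hu')).le
      (hN.unitary _ _ _ (Matrix.diagonal_mem_unitaryGroup hw)
        (Matrix.diagonal_mem_unitaryGroup hv')).le
  rw [h1, Matrix.smul_mul, Matrix.smul_mul, Matrix.add_mul, Matrix.add_mul]
  exact hN.half_add_le (key u hu) (key v hv)

theorem diagonal_diag_le (hN : IsUnitarilyInvariantNorm N) (A : Matrix (Fin n) (Fin n) ℂ) :
    N (Matrix.diagonal A.diag) ≤ N A := by
  have hsum := hN.sum_le Finset.univ fun ε : Fin n → ℤˣ =>
    Matrix.diagonal (fun i => ((ε i : ℤ) : ℂ)) * A * Matrix.diagonal (fun i => ((ε i : ℤ) : ℂ))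
  rw [sum_signs_smul_diagonal_conj, hN.smul, Complex.norm_natCast] at hsum
  have hε : ∀ (ε : Fin n → ℤˣ) i, ‖((ε i : ℤ) : ℂ)‖ = 1 := by
    intro ε i
    rcases Int.units_eq_one_or (ε i) with h | h <;> simp [h]
  have hterm : ∀ ε : Fin n → ℤˣ, N (Matrix.diagonal (fun i => ((ε i : ℤ) : ℂ)) * A *
      Matrix.diagonal (fun i => ((ε i : ℤ) : ℂ))) = N A := fun ε =>
    hN.unitary _ _ _ (Matrix.diagonal_mem_unitaryGroup (hε ε))
      (Matrix.diagonal_mem_unitaryGroup (hε ε))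
  simp only [hterm, Finset.sum_const, Finset.card_univ, nsmul_eq_mul] at hsum
  exact le_of_mul_le_mul_left hsum (by exact_mod_cast Fintype.card_pos)

theorem diagonal_le (hN : IsUnitarilyInvariantNorm N) {d : Fin n → ℂ}
    {A : Matrix (Fin n) (Fin n) ℂ} (h : ∀ i, ‖d i‖ ≤ ‖A i i‖) : N (Matrix.diagonal d) ≤ N A := by
  have hd : Matrix.diagonal d =
      Matrix.diagonal (fun i => d i / A i i) * Matrix.diagonal A.diag *
        Matrix.diagonal (fun _ => 1) := by
    rw [Matrix.diagonal_mul_diagonal, Matrix.diagonal_mul_diagonal]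
    congr 1
    ext i
    by_cases hi : A i i = 0
    · have := h i
      rw [hi, norm_zero, norm_le_zero_iff] at this
      simp [hi, this]
    · simp [hi]
  rw [hd]
  refine (hN.diagonal_mul_mul_diagonal_le (fun i => ?_) (by simp) _).trans (hN.diagonal_diag_le A)
  rw [norm_div]
  exact div_le_one_of_le₀ (h i) (norm_nonneg _)

end IsUnitarilyInvariantNorm

theorem Matrix.norm_conjTranspose_mul_apply_self_le {n : ℕ} (A B : Matrix (Fin n) (Fin n) ℂ)
    (i : Fin n) :
    ‖(Aᴴ * B) i i‖ ≤ ‖((1 / 2 : ℂ) • (Aᴴ * A + Bᴴ * B)) i i‖ := by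
  have h : ((1 / 2 : ℂ) • (Aᴴ * A + Bᴴ * B)) i i =
      ((∑ k, (‖A k i‖ ^ 2 + ‖B k i‖ ^ 2) / 2 : ℝ) : ℂ) := by
    simp only [Matrix.smul_apply, Matrix.add_apply, Matrix.mul_apply, Matrix.conjTranspose_apply,
      RCLike.star_def, Complex.conj_mul', smul_eq_mul]
    rw [← Finset.sum_add_distrib, Finset.mul_sum]
    push_cast
    exact Finset.sum_congr rfl fun k _ => by ring
  rw [h, Complex.norm_real, Matrix.mul_apply]
  refine (norm_sum_le _ _).trans (le_trans ?_ (le_abs_self _))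
  refine Finset.sum_le_sum fun k _ => ?_
  rw [norm_mul, Matrix.conjTranspose_apply, norm_star]
  linarith [two_mul_le_add_sq ‖A k i‖ ‖B k i‖]

/-- The eigenvalues of a Hermitian product `A * B` occur as the diagonal of `B * A` in some
orthonormal basis. -/
theorem Matrix.IsHermitian.exists_unitary_eigenvalues_eq_diag_swap {n : ℕ}
    {A B : Matrix (Fin n) (Fin n) ℂ} (h : (A * B).IsHermitian) :
    ∃ U ∈ Matrix.unitaryGroup (Fin n) ℂ, ∀ i, (h.eigenvalues i : ℂ) = (Uᴴ * (B * A) * U) i i := by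
  obtain ⟨U, hU, hT⟩ := Matrix.exists_unitary_isLowerTriangular (B * A)
  have hUU : U * Uᴴ = 1 := Matrix.mem_unitaryGroup_iff.1 hU
  have hUU' : Uᴴ * U = 1 := Matrix.mem_unitaryGroup_iff'.1 hU
  have hchar : (A * B).charpoly = ∏ i, (Polynomial.X -
      Polynomial.C ((Uᴴ * (B * A) * U) i i)) := by
    have hT' : (Uᴴ * (B * A) * U)ᵀ.IsUpperTriangular := hT.transpose
    have := Matrix.charpoly_of_isUpperTriangular _ hT'
    rw [Matrix.charpoly_transpose, Matrix.charpoly_mul_comm, ← Matrix.mul_assoc, hUU,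
      Matrix.one_mul, Matrix.charpoly_mul_comm] at this
    simpa using this
  have hroots := h.roots_charpoly_eq_eigenvalues
  rw [hchar, Polynomial.roots_prod _ _
    (by simp [Finset.prod_ne_zero_iff, Polynomial.X_sub_C_ne_zero])] at hroots
  simp only [Polynomial.roots_X_sub_C, Multiset.bind_singleton] at hroots
  obtain ⟨σ, hσ⟩ := exists_perm_comp_eq_of_multiset_map_eq hroots.symm
  refine ⟨U.submatrix id σ, ?_, fun i => (congrFun hσ i).symm.trans ?_⟩
  · rw [Matrix.mem_unitaryGroup_iff', Matrix.star_eq_conjTranspose, Matrix.conjTranspose_submatrix,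
      ← Matrix.submatrix_mul _ _ _ _ _ Function.bijective_id, hUU', Matrix.submatrix_one_equiv]
  · simp [Matrix.mul_apply]

/-- Complex powers of a real number, with value `0` at base `0` for every exponent. -/
noncomputable def supportCpow (a : ℝ) (z : ℂ) : ℂ :=
  if a = 0 then 0 else Complex.exp (Real.log a * z)

theorem supportCpow_add (a : ℝ) (z w : ℂ) :
    supportCpow a z * supportCpow a w = supportCpow a (z + w) := by
  unfold supportCpow
  split_ifs
  · simp
  · rw [← Complex.exp_add, mul_add]

theorem star_supportCpow (a : ℝ) (z : ℂ) :
    star (supportCpow a z) = supportCpow a (star z) := by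
  unfold supportCpow
  split_ifs
  · simp
  · simp [← Complex.exp_conj]

theorem supportCpow_ofReal {a s : ℝ} (ha : 0 ≤ a) (hs : s ≠ 0) :
    supportCpow a s = ((a ^ s : ℝ) : ℂ) := by
  unfold supportCpow
  split_ifs with h
  · simp [h, Real.zero_rpow hs]
  · rw [Real.rpow_def_of_pos (lt_of_le_of_ne ha (Ne.symm h))]
    push_cast
    rfl

theorem norm_supportCpow_le_one (a : ℝ) {z : ℂ} (hz : z.re = 0) : ‖supportCpow a z‖ ≤ 1 := by
  unfold supportCpow
  split_ifs
  · simp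
  · simp [Complex.norm_exp, hz]

namespace Matrix.IsHermitian

variable {n : ℕ} {A B : Matrix (Fin n) (Fin n) ℂ}

/-- Complex powers of a Hermitian matrix, taken on its support only. -/
noncomputable def cpow (hA : A.IsHermitian) (z : ℂ) : Matrix (Fin n) (Fin n) ℂ :=
  (hA.eigenvectorUnitary : Matrix (Fin n) (Fin n) ℂ) *
    Matrix.diagonal (fun i => supportCpow (hA.eigenvalues i) z) *
    (hA.eigenvectorUnitary : Matrix (Fin n) (Fin n) ℂ)ᴴ

theorem eigenvectorUnitary_conjTranspose_mul_self (hA : A.IsHermitian) :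
    (hA.eigenvectorUnitary : Matrix (Fin n) (Fin n) ℂ)ᴴ * hA.eigenvectorUnitary = 1 :=
  Matrix.mem_unitaryGroup_iff'.1 hA.eigenvectorUnitary.2

theorem eq_eigenvectorUnitary_mul_diagonal_mul (hA : A.IsHermitian) :
    A = (hA.eigenvectorUnitary : Matrix (Fin n) (Fin n) ℂ) *
      Matrix.diagonal (fun i => (hA.eigenvalues i : ℂ)) *
      (hA.eigenvectorUnitary : Matrix (Fin n) (Fin n) ℂ)ᴴ :=
  hA.spectral_theorem

theorem conjTranspose_eigenvectorUnitary_mul_mul (hA : A.IsHermitian) :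
    (hA.eigenvectorUnitary : Matrix (Fin n) (Fin n) ℂ)ᴴ * A * hA.eigenvectorUnitary =
      Matrix.diagonal (fun i => (hA.eigenvalues i : ℂ)) := by
  have h := hA.eigenvectorUnitary_conjTranspose_mul_self
  refine (congrArg (fun M => (hA.eigenvectorUnitary : Matrix (Fin n) (Fin n) ℂ)ᴴ * M *
    hA.eigenvectorUnitary) hA.eq_eigenvectorUnitary_mul_diagonal_mul).trans ?_
  simp only [Matrix.mul_assoc]
  rw [h, Matrix.mul_one, ← Matrix.mul_assoc, h, Matrix.one_mul]

theorem cpow_add (hA : A.IsHermitian) (z w : ℂ) : hA.cpow z * hA.cpow w = hA.cpow (z + w) := by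
  unfold cpow
  simp only [Matrix.mul_assoc]
  rw [← Matrix.mul_assoc _ᴴ, hA.eigenvectorUnitary_conjTranspose_mul_self, Matrix.one_mul,
    ← Matrix.mul_assoc (Matrix.diagonal _) (Matrix.diagonal _), Matrix.diagonal_mul_diagonal]
  simp only [supportCpow_add]

theorem conjTranspose_cpow (hA : A.IsHermitian) (z : ℂ) : (hA.cpow z)ᴴ = hA.cpow (star z) := by
  unfold cpow
  simp only [Matrix.conjTranspose_mul, Matrix.conjTranspose_conjTranspose,
    Matrix.diagonal_conjTranspose, Matrix.mul_assoc]
  congr 3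
  ext i
  simp [star_supportCpow]

theorem isHermitian_cpow_ofReal (hA : A.IsHermitian) (s : ℝ) : (hA.cpow s).IsHermitian := by
  rw [Matrix.IsHermitian, conjTranspose_cpow]
  simp

end Matrix.IsHermitian

theorem psdPow_eq_cpow {n : ℕ} {A : Matrix (Fin n) (Fin n) ℂ} (hA : A.PosSemidef) {s : ℝ}
    (hs : s ≠ 0) : psdPow A s = hA.1.cpow s := by
  rw [psdPow, dif_pos hA.1, Matrix.IsHermitian.cpow]
  simp only [supportCpow_ofReal (hA.eigenvalues_nonneg _) hs]

theorem Matrix.PosSemidef.cpow_one {n : ℕ} {A : Matrix (Fin n) (Fin n) ℂ} (hA : A.PosSemidef) :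
    hA.1.cpow 1 = A := by
  have := fun i => supportCpow_ofReal (hA.eigenvalues_nonneg i) one_ne_zero
  simp only [Complex.ofReal_one, Real.rpow_one] at this
  rw [Matrix.IsHermitian.cpow]
  simp only [this]
  exact hA.1.eq_eigenvectorUnitary_mul_diagonal_mul.symm

namespace IsUnitarilyInvariantNorm

variable {n : ℕ} {N : Matrix (Fin n) (Fin n) ℂ → ℝ} {A B : Matrix (Fin n) (Fin n) ℂ}

theorem cpow_mul_mul_cpow_le (hN : IsUnitarilyInvariantNorm N) (hA : A.IsHermitian)
    (hB : B.IsHermitian) {z w : ℂ} (hz : z.re = 0) (hw : w.re = 0)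
    (M : Matrix (Fin n) (Fin n) ℂ) : N (hA.cpow z * M * hB.cpow w) ≤ N M := by
  have h : hA.cpow z * M * hB.cpow w =
      (hA.eigenvectorUnitary : Matrix (Fin n) (Fin n) ℂ) *
        (Matrix.diagonal (fun i => supportCpow (hA.eigenvalues i) z) *
          ((hA.eigenvectorUnitary : Matrix (Fin n) (Fin n) ℂ)ᴴ * M *
            (hB.eigenvectorUnitary : Matrix (Fin n) (Fin n) ℂ)) *
          Matrix.diagonal (fun i => supportCpow (hB.eigenvalues i) w)) *
        (hB.eigenvectorUnitary : Matrix (Fin n) (Fin n) ℂ)ᴴ := by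
    simp only [Matrix.IsHermitian.cpow, Matrix.mul_assoc]
  rw [h, hN.unitary _ _ _ hA.eigenvectorUnitary.2
    (Matrix.conjTranspose_mem_unitaryGroup hB.eigenvectorUnitary.2)]
  refine (hN.diagonal_mul_mul_diagonal_le (fun i => norm_supportCpow_le_one _ hz)
    (fun i => norm_supportCpow_le_one _ hw) _).trans ?_
  rw [hN.unitary _ _ _ (Matrix.conjTranspose_mem_unitaryGroup hA.eigenvectorUnitary.2)
    hB.eigenvectorUnitary.2]

theorem eq_diagonal_eigenvalues (hN : IsUnitarilyInvariantNorm N) (hA : A.IsHermitian) :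
    N A = N (Matrix.diagonal (fun i => (hA.eigenvalues i : ℂ))) := by
  rw [← hA.conjTranspose_eigenvectorUnitary_mul_mul, hN.conj_eq hA.eigenvectorUnitary.2]

theorem le_add_of_posSemidef (hN : IsUnitarilyInvariantNorm N) (hA : A.PosSemidef)
    (hB : B.PosSemidef) : N A ≤ N (A + B) := by
  rw [hN.eq_diagonal_eigenvalues hA.1, ← hN.conj_eq hA.1.eigenvectorUnitary.2 (A + B)]
  refine hN.diagonal_le fun i => ?_
  rw [Matrix.mul_add, Matrix.add_mul, hA.1.conjTranspose_eigenvectorUnitary_mul_mul,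
    Matrix.add_apply, Matrix.diagonal_apply_eq]
  have h := (hB.conjTranspose_mul_mul_same
    (hA.1.eigenvectorUnitary : Matrix (Fin n) (Fin n) ℂ)).diag_nonneg (i := i)
  rw [Complex.norm_of_nonneg (hA.eigenvalues_nonneg i)]
  refine le_trans ?_ (Complex.re_le_norm _)
  rw [Complex.add_re, Complex.ofReal_re]
  linarith [(Complex.le_def.1 h).1, Complex.zero_re]

/-- An arithmetic-geometric mean inequality for unitarily invariant norms. -/
theorem mul_mul_le_half (hN : IsUnitarilyInvariantNorm N) (hA : A.IsHermitian)
    (hB : B.IsHermitian) :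
    N (A * B * A) ≤ (1 / 2) * N ((A * A) * (A * A) + B * B) := by
  have hH : (A * B * A).IsHermitian := by
    simpa [hA.eq] using Matrix.isHermitian_conjTranspose_mul_mul A hB
  obtain ⟨U, hU, hdiag⟩ := hH.exists_unitary_eigenvalues_eq_diag_swap
  have h1 : Uᴴ * (A * (A * B)) * U = (A * A * U)ᴴ * (B * U) := by
    simp only [Matrix.conjTranspose_mul, hA.eq, Matrix.mul_assoc]
  have h2 : (A * A * U)ᴴ * (A * A * U) + (B * U)ᴴ * (B * U) =
      Uᴴ * ((A * A) * (A * A) + B * B) * U := by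
    simp only [Matrix.conjTranspose_mul, hA.eq, hB.eq, Matrix.mul_assoc, Matrix.mul_add,
      Matrix.add_mul]
  rw [hN.eq_diagonal_eigenvalues hH]
  refine (hN.diagonal_le fun i => ?_).trans (b := N ((1 / 2 : ℂ) •
    (Uᴴ * ((A * A) * (A * A) + B * B) * U))) ?_
  · rw [hdiag i, h1, ← h2]
    exact Matrix.norm_conjTranspose_mul_apply_self_le _ _ i
  · rw [hN.smul, hN.conj_eq hU]
    norm_num

end IsUnitarilyInvariantNorm

/-- Entire functions bounded on the closed strip `0 ≤ re z ≤ 1 / 4`. -/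
def IsEntireBddOnStrip (f : ℂ → ℂ) : Prop :=
  Differentiable ℂ f ∧ ∃ C, ∀ z : ℂ, z.re ∈ Set.Icc (0 : ℝ) (1 / 4) → ‖f z‖ ≤ C

namespace IsEntireBddOnStrip

variable {f g : ℂ → ℂ}

theorem const (c : ℂ) : IsEntireBddOnStrip fun _ => c :=
  ⟨differentiable_const c, ‖c‖, fun _ _ => le_rfl⟩

theorem mul (hf : IsEntireBddOnStrip f) (hg : IsEntireBddOnStrip g) :
    IsEntireBddOnStrip fun z => f z * g z := by
  obtain ⟨hf, C, hC⟩ := hf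
  obtain ⟨hg, D, hD⟩ := hg
  refine ⟨hf.mul hg, C * D, fun z hz => ?_⟩
  rw [norm_mul]
  exact mul_le_mul (hC z hz) (hD z hz) (norm_nonneg _) ((norm_nonneg _).trans (hC z hz))

theorem sum {ι : Type*} {s : Finset ι} {f : ι → ℂ → ℂ} (hf : ∀ i, IsEntireBddOnStrip (f i)) :
    IsEntireBddOnStrip fun z => ∑ i ∈ s, f i z := by
  choose hd C hC using hf
  exact ⟨Differentiable.fun_sum fun i _ => hd i, ∑ i ∈ s, C i, fun z hz =>
    (norm_sum_le _ _).trans (Finset.sum_le_sum fun i _ => hC i z hz)⟩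

theorem supportCpow_affine (a α β : ℝ) :
    IsEntireBddOnStrip fun z => supportCpow a (α + β * z) := by
  unfold supportCpow
  split_ifs
  · exact const 0
  · refine ⟨by fun_prop, Real.exp (|Real.log a| * (|α| + |β|)), fun z hz => ?_⟩
    rw [Complex.norm_exp]
    refine Real.exp_le_exp.2 ?_
    have hre : (Real.log a * (α + β * z) : ℂ).re = Real.log a * (α + β * z.re) := by
      simp
    rw [hre]
    refine (le_abs_self _).trans ?_
    rw [abs_mul]
    refine mul_le_mul_of_nonneg_left ((abs_add_le _ _).trans ?_) (abs_nonneg _)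
    rw [abs_mul, abs_of_nonneg hz.1]
    have := mul_le_mul_of_nonneg_left (hz.2.trans (by norm_num : (1 / 4 : ℝ) ≤ 1)) (abs_nonneg β)
    linarith

end IsEntireBddOnStrip

/-- Matrix-valued functions all of whose entries satisfy `IsEntireBddOnStrip`. -/
def Matrix.IsEntireBddOnStrip {n : ℕ} (F : ℂ → Matrix (Fin n) (Fin n) ℂ) : Prop :=
  ∀ i j, _root_.IsEntireBddOnStrip fun z => F z i j

namespace Matrix.IsEntireBddOnStrip

variable {n : ℕ} {F G : ℂ → Matrix (Fin n) (Fin n) ℂ}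

theorem const (A : Matrix (Fin n) (Fin n) ℂ) : Matrix.IsEntireBddOnStrip fun _ => A :=
  fun _ _ => _root_.IsEntireBddOnStrip.const _

theorem mul (hF : Matrix.IsEntireBddOnStrip F) (hG : Matrix.IsEntireBddOnStrip G) :
    Matrix.IsEntireBddOnStrip fun z => F z * G z := by
  intro i j
  simp only [Matrix.mul_apply]
  exact _root_.IsEntireBddOnStrip.sum fun k => (hF i k).mul (hG k j)

theorem cpow_affine {A : Matrix (Fin n) (Fin n) ℂ} (hA : A.IsHermitian) (α β : ℝ) :
    Matrix.IsEntireBddOnStrip fun z => hA.cpow (α + β * z) := by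
  refine ((const _).mul fun i j => ?_).mul (const _)
  by_cases hij : i = j
  · subst hij
    simpa using _root_.IsEntireBddOnStrip.supportCpow_affine _ α β
  · simpa [Matrix.diagonal_apply_ne _ hij] using _root_.IsEntireBddOnStrip.const 0

end Matrix.IsEntireBddOnStrip

/-- The three lines theorem on `0 ≤ re z ≤ 1 / 4` for functions in a finite-dimensional span. -/
theorem norm_sum_smul_le_interp {E ι : Type*} [NormedAddCommGroup E] [NormedSpace ℂ E]
    [Fintype ι] (e : ι → E) {f : ι → ℂ → ℂ} (hf : ∀ i, IsEntireBddOnStrip (f i)) {a b : ℝ}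
    (ha : ∀ z : ℂ, z.re = 0 → ‖∑ i, f i z • e i‖ ≤ a)
    (hb : ∀ z : ℂ, z.re = 1 / 4 → ‖∑ i, f i z • e i‖ ≤ b)
    {z : ℂ} (hz : z.re ∈ Set.Icc (0 : ℝ) (1 / 4)) :
    ‖∑ i, f i z • e i‖ ≤ a ^ (1 - 4 * z.re) * b ^ (4 * z.re) := by
  choose hd C hC using hf
  have hdiff : Differentiable ℂ fun z => ∑ i, f i z • e i :=
    Differentiable.fun_sum fun i _ => (hd i).smul_const (e i)
  have h := Complex.HadamardThreeLines.norm_le_interp_of_mem_verticalClosedStrip'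
    (f := fun z => ∑ i, f i z • e i) (z := z) (a := a) (b := b) (l := 0) (u := 1 / 4)
    (by norm_num) hz hdiff.diffContOnCl ?_ ha hb
  · convert h using 3 <;> ring
  · refine ⟨∑ i, C i * ‖e i‖, ?_⟩
    rintro _ ⟨w, hw, rfl⟩
    refine (norm_sum_le _ _).trans (Finset.sum_le_sum fun i _ => ?_)
    rw [norm_smul]
    exact mul_le_mul_of_nonneg_right (hC i w hw) (norm_nonneg _)

namespace IsUnitarilyInvariantNorm

variable {n : ℕ} {N : Matrix (Fin n) (Fin n) ℂ → ℝ} {x y : Matrix (Fin n) (Fin n) ℂ}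

theorem diagonal_le_interp (hN : IsUnitarilyInvariantNorm N) {f : Fin n → ℂ → ℂ}
    (hf : ∀ i, IsEntireBddOnStrip (f i)) {a b : ℝ}
    (ha : ∀ z : ℂ, z.re = 0 → N (Matrix.diagonal fun i => f i z) ≤ a)
    (hb : ∀ z : ℂ, z.re = 1 / 4 → N (Matrix.diagonal fun i => f i z) ≤ b)
    {z : ℂ} (hz : z.re ∈ Set.Icc (0 : ℝ) (1 / 4)) :
    N (Matrix.diagonal fun i => f i z) ≤ a ^ (1 - 4 * z.re) * b ^ (4 * z.re) := by
  let _ : Norm (Matrix (Fin n) (Fin n) ℂ) := ⟨N⟩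
  have core : NormedSpace.Core ℂ (Matrix (Fin n) (Fin n) ℂ) :=
    { norm_nonneg := hN.nonneg
      norm_smul := hN.smul
      norm_triangle := hN.add_le
      norm_eq_zero_iff := hN.eq_zero_iff }
  let _ : NormedAddCommGroup (Matrix (Fin n) (Fin n) ℂ) := NormedAddCommGroup.ofCore core
  let _ : NormedSpace ℂ (Matrix (Fin n) (Fin n) ℂ) := NormedSpace.ofCore core
  have hsum : ∀ w, Matrix.diagonal (fun i => f i w) =
      ∑ i, f i w • (Matrix.single i i 1 : Matrix (Fin n) (Fin n) ℂ) := by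
    intro w
    ext k l
    rcases eq_or_ne k l with rfl | hkl
    · simp [Matrix.sum_apply, Matrix.single_apply]
    · rw [Matrix.diagonal_apply_ne _ hkl, Matrix.sum_apply, Finset.sum_eq_zero]
      intro i _
      rw [Matrix.smul_apply, Matrix.single_apply, if_neg (fun h => hkl (h.1.symm.trans h.2)),
        smul_zero]
  simp only [hsum] at ha hb ⊢
  exact norm_sum_smul_le_interp (E := Matrix (Fin n) (Fin n) ℂ)
    (fun i => Matrix.single i i 1) hf ha hb hz

theorem cpow_mul_cpow_mul_cpow_le_of_re_eq_zero (hN : IsUnitarilyInvariantNorm N)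
    (hx : x.PosSemidef) (hy : y.PosSemidef) {z : ℂ} (hz : z.re = 0) :
    N (hy.1.cpow z * hx.1.cpow (1 - 2 * z) * hy.1.cpow z) ≤ N x := by
  refine (hN.cpow_mul_mul_cpow_le hy.1 hy.1 hz hz _).trans ?_
  have h : hx.1.cpow (1 - 2 * z) = hx.1.cpow (-z) * x * hx.1.cpow (-z) := by
    conv_rhs => rw [← congrArg (fun M => hx.1.cpow (-z) * M * hx.1.cpow (-z)) hx.cpow_one]
    simp only [Matrix.IsHermitian.cpow_add]
    congr 1
    ring
  rw [h]
  exact hN.cpow_mul_mul_cpow_le hx.1 hx.1 (by simp [hz]) (by simp [hz]) x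

theorem diagonal_conj_cpow_le_of_re_eq_quarter (hN : IsUnitarilyInvariantNorm N)
    (hx : x.PosSemidef) (hy : y.PosSemidef) {W : Matrix (Fin n) (Fin n) ℂ}
    (hW : W ∈ Matrix.unitaryGroup (Fin n) ℂ) {z : ℂ} (hz : z.re = 1 / 4) :
    N (Matrix.diagonal fun i =>
      (Wᴴ * (hy.1.cpow z * hx.1.cpow (1 - 2 * z) * hy.1.cpow z) * W) i i) ≤
      (1 / 2) * N (x + y) := by
  set P := hy.1.cpow ((1 / 4 : ℝ) : ℂ) with hP
  set Q := hx.1.cpow ((1 / 2 : ℝ) : ℂ) with hQ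
  have hstar : star z = 1 / 2 - z := by
    apply Complex.ext <;> simp [hz]
    norm_num
  have hPQ : N (P * Q * P) ≤ (1 / 2) * N (x + y) := by
    have h := hN.mul_mul_le_half (hy.1.isHermitian_cpow_ofReal (1 / 4))
      (hx.1.isHermitian_cpow_ofReal (1 / 2))
    have h1 : ((1 / 4 : ℝ) : ℂ) + ((1 / 4 : ℝ) : ℂ) + (((1 / 4 : ℝ) : ℂ) + ((1 / 4 : ℝ) : ℂ)) = 1 := by
      push_cast
      norm_num
    have h2 : ((1 / 2 : ℝ) : ℂ) + ((1 / 2 : ℝ) : ℂ) = 1 := by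
      push_cast
      norm_num
    rwa [hy.1.cpow_add, hy.1.cpow_add, hx.1.cpow_add, h1, h2, hx.cpow_one, hy.cpow_one,
      add_comm y x] at h
  set A := hx.1.cpow (1 / 4 : ℂ) * hy.1.cpow (star z) * W with hA
  set B := hx.1.cpow (3 / 4 - 2 * z) * hy.1.cpow z * W with hB
  have hAB : Wᴴ * (hy.1.cpow z * hx.1.cpow (1 - 2 * z) * hy.1.cpow z) * W = Aᴴ * B := by
    have e : (1 - 2 * z : ℂ) = star (1 / 4 : ℂ) + (3 / 4 - 2 * z) := by
      simp
      ring
    rw [e, ← hx.1.cpow_add]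
    simp only [hA, hB, Matrix.conjTranspose_mul, Matrix.IsHermitian.conjTranspose_cpow, star_star,
      Matrix.mul_assoc]
  set V := hy.1.cpow (z - 1 / 4) with hV
  set V' := hy.1.cpow (1 / 4 - z) with hV'
  have hQ' : ∀ u v : ℂ, u + v = 1 / 2 → hx.1.cpow u * hx.1.cpow v = Q := by
    intro u v huv
    rw [hx.1.cpow_add, huv, hQ]
    push_cast
    rfl
  have hPV : V * P = hy.1.cpow z ∧ P * V = hy.1.cpow z := by
    constructor <;> rw [hV, hP, hy.1.cpow_add] <;> congr 1 <;> push_cast <;> ring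
  have hPV' : V' * P = hy.1.cpow (star z) ∧ P * V' = hy.1.cpow (star z) := by
    constructor <;> rw [hV', hP, hy.1.cpow_add, hstar] <;> congr 1 <;> push_cast <;> ring
  have hAA : Aᴴ * A = Wᴴ * (V * (P * Q * P) * V') * W := by
    have e : Aᴴ * A = Wᴴ * (hy.1.cpow z * (hx.1.cpow (1 / 4) * hx.1.cpow (1 / 4)) *
        hy.1.cpow (star z)) * W := by
      simp [hA, Matrix.conjTranspose_mul, Matrix.IsHermitian.conjTranspose_cpow, Matrix.mul_assoc]
    rw [e, hQ' _ _ (by norm_num), ← hPV.1, ← hPV'.2]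
    simp only [Matrix.mul_assoc]
  have hBB : Bᴴ * B = Wᴴ * (V' * (P * Q * P) * V) * W := by
    have e : Bᴴ * B = Wᴴ * (hy.1.cpow (star z) * (hx.1.cpow (star (3 / 4 - 2 * z)) *
        hx.1.cpow (3 / 4 - 2 * z)) * hy.1.cpow z) * W := by
      simp only [hB, Matrix.conjTranspose_mul, Matrix.IsHermitian.conjTranspose_cpow,
        Matrix.mul_assoc]
    have e' : star (3 / 4 - 2 * z) + (3 / 4 - 2 * z) = 1 / 2 := by
      have : star (3 / 4 - 2 * z) = 3 / 4 - 2 * star z := by simp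
      rw [this, hstar]
      ring
    rw [e, hQ' _ _ e', ← hPV'.1, ← hPV.2]
    simp only [Matrix.mul_assoc]
  refine (hN.diagonal_le fun i => ?_).trans (b := N ((1 / 2 : ℂ) • (Aᴴ * A + Bᴴ * B))) ?_
  · rw [hAB]
    exact Matrix.norm_conjTranspose_mul_apply_self_le A B i
  · have hre : (z - 1 / 4).re = 0 ∧ (1 / 4 - z).re = 0 := by
      constructor <;> simp [hz]
    refine hN.half_add_le ?_ ?_
    · rw [hAA, hN.conj_eq hW]
      exact (hN.cpow_mul_mul_cpow_le hy.1 hy.1 hre.1 hre.2 _).trans hPQ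
    · rw [hBB, hN.conj_eq hW]
      exact (hN.cpow_mul_mul_cpow_le hy.1 hy.1 hre.2 hre.1 _).trans hPQ

theorem psdPow_mul_psdPow_mul_psdPow_le (hN : IsUnitarilyInvariantNorm N)
    (hx : x.PosSemidef) (hy : y.PosSemidef) {s : ℝ} (hs : s ∈ Set.Ioo (0 : ℝ) (1 / 4)) :
    N (psdPow y s * psdPow x (1 - 2 * s) * psdPow y s) ≤ 2 ^ (-(4 * s)) * N (x + y) := by
  rw [psdPow_eq_cpow hy hs.1.ne', psdPow_eq_cpow hx (by linarith [hs.2])]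
  set F : ℂ → Matrix (Fin n) (Fin n) ℂ := fun z =>
    hy.1.cpow z * hx.1.cpow (1 - 2 * z) * hy.1.cpow z with hF
  have hFs : hy.1.cpow s * hx.1.cpow ((1 - 2 * s : ℝ) : ℂ) * hy.1.cpow s = F s := by
    simp [hF]
  rw [hFs]
  have hH : (F s).IsHermitian := by
    rw [← hFs]
    simpa [(hy.1.isHermitian_cpow_ofReal s).eq] using
      Matrix.isHermitian_conjTranspose_mul_mul (hy.1.cpow s)
        (hx.1.isHermitian_cpow_ofReal (1 - 2 * s))
  obtain ⟨W, hW, hWd⟩ : ∃ W ∈ Matrix.unitaryGroup (Fin n) ℂ,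
      N (F s) = N (Matrix.diagonal fun i => (Wᴴ * F s * W) i i) := by
    refine ⟨hH.eigenvectorUnitary, hH.eigenvectorUnitary.2, ?_⟩
    rw [hN.eq_diagonal_eigenvalues hH, hH.conjTranspose_eigenvectorUnitary_mul_mul]
    simp
  have hFb : Matrix.IsEntireBddOnStrip fun z => Wᴴ * F z * W := by
    have h1 : Matrix.IsEntireBddOnStrip fun z => hy.1.cpow z := by
      simpa using Matrix.IsEntireBddOnStrip.cpow_affine hy.1 0 1
    have h2 : Matrix.IsEntireBddOnStrip fun z => hx.1.cpow (1 - 2 * z) := by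
      simpa [sub_eq_add_neg] using Matrix.IsEntireBddOnStrip.cpow_affine hx.1 1 (-2)
    exact ((Matrix.IsEntireBddOnStrip.const _).mul ((h1.mul h2).mul h1)).mul
      (Matrix.IsEntireBddOnStrip.const _)
  have h := hN.diagonal_le_interp (z := (s : ℂ)) (a := N (x + y)) (b := (1 / 2) * N (x + y))
    (fun i => hFb i i) (fun z hz => ?_)
    (fun z hz => hN.diagonal_conj_cpow_le_of_re_eq_quarter hx hy hW hz)
    (by simpa using ⟨hs.1.le, by linarith [hs.2]⟩)
  · rw [hWd]
    refine h.trans_eq ?_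
    rw [Complex.ofReal_re, Real.mul_rpow (by norm_num) (hN.nonneg _), mul_left_comm,
      ← Real.rpow_add' (hN.nonneg _) (by norm_num), sub_add_cancel, Real.rpow_one,
      Real.rpow_neg (by norm_num), one_div, Real.inv_rpow (by norm_num)]
  · refine ((hN.diagonal_diag_le _).trans_eq (hN.conj_eq hW _)).trans ?_
    exact (hN.cpow_mul_cpow_mul_cpow_le_of_re_eq_zero hx hy hz).trans
      (hN.le_add_of_posSemidef hx hy)

end IsUnitarilyInvariantNorm

theorem stmt14 {n : ℕ} (x y : Matrix (Fin n) (Fin n) ℂ)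
    (hx : x.PosSemidef) (hy : y.PosSemidef)
    (N : Matrix (Fin n) (Fin n) ℂ → ℝ)
    (hN_add : ∀ A B, N (A + B) ≤ N A + N B)
    (hN_smul : ∀ (c : ℂ) A, N (c • A) = ‖c‖ * N A)
    (hN_zero : ∀ A, N A = 0 ↔ A = 0)
    (hN_unitary : ∀ (A U V : Matrix (Fin n) (Fin n) ℂ),
      U ∈ Matrix.unitaryGroup (Fin n) ℂ → V ∈ Matrix.unitaryGroup (Fin n) ℂ →
      N (U * A * V) = N A)
    (t : ℝ) (ht : t ∈ Set.Ioo (3/4 : ℝ) 1) :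
    N (psdPow y (1 - t) * psdPow x (2*t - 1) * psdPow y (1 - t) +
        psdPow x (1 - t) * psdPow y (2*t - 1) * psdPow x (1 - t)) ≤
      (2 : ℝ) ^ (4 * (t - 3/4)) * N (x + y) := by
  have hN : IsUnitarilyInvariantNorm N := ⟨hN_add, hN_smul, hN_zero, hN_unitary⟩
  have hs : 1 - t ∈ Set.Ioo (0 : ℝ) (1 / 4) := ⟨by linarith [ht.2], by linarith [ht.1]⟩
  have h1 := hN.psdPow_mul_psdPow_mul_psdPow_le hx hy hs
  have h2 := hN.psdPow_mul_psdPow_mul_psdPow_le hy hx hs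
  have e1 : 1 - 2 * (1 - t) = 2 * t - 1 := by ring
  have e2 : (2 : ℝ) ^ (4 * (t - 3 / 4)) = 2 * 2 ^ (-(4 * (1 - t))) := by
    rw [← Real.rpow_one_add' (by norm_num) (by linarith [ht.1])]
    congr 1
    ring
  rw [e1] at h1 h2
  rw [add_comm y x] at h2
  rw [e2]
  linarith [hN.add_le (psdPow y (1 - t) * psdPow x (2 * t - 1) * psdPow y (1 - t))
    (psdPow x (1 - t) * psdPow y (2 * t - 1) * psdPow x (1 - t))]
end
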